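/- arXiv:math/0209315 — 6 statements merged into one kernel-verified Lean document; each statement's English description precedes it below -/
import Mathlib

section
/- Let F be a finite field with q elements. The number of invertible alternating 6×6 matrices over F (i.e. matrices A with Aᵀ = −A, all diagonal entries zero, and det A a unit) equals q⁶(q⁵−1)(q³−1)(q−1). -/
open Matrix

namespace AltCount

/-- alternating matrices -/
def Alt {F κ : Type*} [Field F] (A : Matrix κ κ F) : Prop := Aᵀ = -A ∧ ∀ i, A i i = 0

/-- invertible alternating matrices -/
abbrev T (F κ : Type*) [Field F] [Fintype κ] [DecidableEq κ] :=
  {A : Matrix κ κ F // Alt A ∧ IsUnit A.det}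

/-- bordered matrix -/
def bord {F κ : Type*} [Field F] (v : κ → F) (B : Matrix κ κ F) :
    Matrix (Unit ⊕ κ) (Unit ⊕ κ) F :=
  Matrix.fromBlocks 0 (Matrix.replicateRow Unit v) (-Matrix.replicateCol Unit v) B

abbrev M {F κ : Type*} [Field F] [Fintype κ] [DecidableEq κ] (v : κ → F) :=
  {B : Matrix κ κ F // Alt B ∧ IsUnit (bord v B).det}

lemma alt_bord {F κ : Type*} [Field F] (v : κ → F) (B : Matrix κ κ F) :
    Alt (bord v B) ↔ Alt B := by
  unfold Alt bord
  constructor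
  · rintro ⟨h1, h2⟩
    refine ⟨?_, fun i => by simpa using h2 (Sum.inr i)⟩
    ext i j
    simpa using congrFun (congrFun h1 (Sum.inr i)) (Sum.inr j)
  · rintro ⟨h1, h2⟩
    refine ⟨?_, ?_⟩
    · ext i j
      rcases i with i | i <;> rcases j with j | j <;> simp
      simpa using congrFun (congrFun h1 i) j
    · rintro (i | i)
      · simp
      · simpa using h2 i

lemma alt_eq_bord {F κ : Type*} [Field F] (A : Matrix (Unit ⊕ κ) (Unit ⊕ κ) F) (h : Alt A) :
    bord (fun j => A (Sum.inl ()) (Sum.inr j)) A.toBlocks₂₂ = A := by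
  ext i j
  rcases i with i | i <;> rcases j with j | j <;> simp [bord]
  · exact (h.2 (Sum.inl ())).symm
  · have := congrFun (congrFun h.1 (Sum.inr i)) (Sum.inl ())
    simp at this
    rw [this, neg_neg]
  · rfl

lemma card_T {F κ : Type*} [Field F] [Fintype F] [Fintype κ] [DecidableEq κ] :
    Nat.card (T F (Unit ⊕ κ)) = ∑ v : κ → F, Nat.card (M v) := by
  classical
  rw [← Nat.card_sigma]
  refine Nat.card_congr ⟨fun A => ⟨fun j => A.1 (Sum.inl ()) (Sum.inr j), A.1.toBlocks₂₂, ?_, ?_⟩,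
    fun p => ⟨bord p.1 p.2.1, (alt_bord _ _).2 p.2.2.1, p.2.2.2⟩, ?_, ?_⟩
  · rw [← alt_bord, alt_eq_bord _ A.2.1]; exact A.2.1
  · rw [alt_eq_bord _ A.2.1]; exact A.2.2
  · intro A; exact Subtype.ext (alt_eq_bord _ A.2.1)
  · rintro ⟨v, B, h⟩
    simp [bord]

lemma alt_conj {F κ : Type*} [Field F] [Fintype κ] [DecidableEq κ] (g B : Matrix κ κ F)
    (h : Alt B) : Alt (g * B * gᵀ) := by
  refine ⟨?_, ?_⟩
  · rw [Matrix.transpose_mul, Matrix.transpose_mul, h.1]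
    simp [Matrix.mul_assoc]
  · intro i
    have key : ∀ x : κ → F, x ⬝ᵥ B *ᵥ x = 0 := by
      intro x
      simp only [dotProduct, mulVec, Finset.mul_sum]
      rw [← Finset.sum_product']
      refine Finset.sum_involution (fun p _ => (p.2, p.1)) ?_ ?_ ?_ ?_
      · rintro ⟨a, b⟩ -
        have := congrFun (congrFun h.1 a) b
        simp at this
        simp [this]; ring
      · rintro ⟨a, b⟩ - hne heq
        simp at heq
        apply hne
        simp [heq.1, h.2]
      · simp
      · simp
    have := key (g i)
    rw [← this, Matrix.mul_assoc]
    simp [Matrix.mul_apply, dotProduct, mulVec]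

lemma det_conj {F κ : Type*} [Field F] [Fintype κ] [DecidableEq κ] (g B : Matrix κ κ F)
    (v : κ → F) (hg : IsUnit g.det) (h : IsUnit (bord v B).det) :
    IsUnit (bord (g *ᵥ v) (g * B * gᵀ)).det := by
  have : bord (g *ᵥ v) (g * B * gᵀ) =
      Matrix.fromBlocks (1 : Matrix Unit Unit F) 0 0 g * bord v B *
        (Matrix.fromBlocks (1 : Matrix Unit Unit F) 0 0 g)ᵀ := by
    simp only [bord, Matrix.fromBlocks_transpose, Matrix.fromBlocks_multiply]
    ext i j
    rcases i with i | i <;> rcases j with j | j <;>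
      simp [Matrix.mul_apply, mulVec, dotProduct, mul_comm]
  rw [this, Matrix.det_mul, Matrix.det_mul, Matrix.det_transpose]
  simp only [Matrix.det_fromBlocks_zero₂₁, Matrix.det_one, one_mul]
  exact (hg.mul h).mul hg

lemma card_M_congr {F κ : Type*} [Field F] [Fintype κ] [DecidableEq κ]
    (g : Matrix κ κ F) (hg : IsUnit g.det) (v : κ → F) :
    Nat.card (M v) = Nat.card (M (g *ᵥ v)) := by
  have h1 : g⁻¹ * g = 1 := Matrix.nonsing_inv_mul g hg
  have h2 : g * g⁻¹ = 1 := Matrix.mul_nonsing_inv g hg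
  have h1t : gᵀ * (g⁻¹)ᵀ = 1 := by rw [← Matrix.transpose_mul, h1, Matrix.transpose_one]
  have h2t : (g⁻¹)ᵀ * gᵀ = 1 := by rw [← Matrix.transpose_mul, h2, Matrix.transpose_one]
  refine Nat.card_congr ⟨fun B => ⟨g * B.1 * gᵀ, alt_conj _ _ B.2.1, det_conj _ _ _ hg B.2.2⟩,
    fun B => ⟨g⁻¹ * B.1 * (g⁻¹)ᵀ, alt_conj _ _ B.2.1, ?_⟩, ?_, ?_⟩
  · have := det_conj g⁻¹ B.1 _ (Matrix.isUnit_nonsing_inv_det g hg) B.2.2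
    rwa [Matrix.mulVec_mulVec, h1, Matrix.one_mulVec] at this
  · intro B
    apply Subtype.ext
    calc g⁻¹ * (g * B.1 * gᵀ) * (g⁻¹)ᵀ = (g⁻¹ * g) * B.1 * (gᵀ * (g⁻¹)ᵀ) := by
          simp only [Matrix.mul_assoc]
      _ = B.1 := by rw [h1, h1t]; simp
  · intro B
    apply Subtype.ext
    calc g * (g⁻¹ * B.1 * (g⁻¹)ᵀ) * gᵀ = (g * g⁻¹) * B.1 * ((g⁻¹)ᵀ * gᵀ) := by
          simp only [Matrix.mul_assoc]
      _ = B.1 := by rw [h2, h2t]; simp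

lemma card_M_zero {F κ : Type*} [Field F] [Fintype κ] [DecidableEq κ] :
    Nat.card (M (0 : κ → F)) = 0 := by
  have : IsEmpty (M (0 : κ → F)) := by
    refine ⟨fun B => ?_⟩
    have h := B.2.2
    rw [Matrix.det_eq_zero_of_row_eq_zero (Sum.inl ())] at h
    · simp at h
    · rintro (j | j) <;> simp [bord]
  simp

/-- first basis vector -/
def e (F ι : Type*) [Field F] : Unit ⊕ ι → F := Sum.elim (fun _ => 1) (fun _ => 0)

lemma unit_bord {F ι : Type*} [Field F] [Fintype ι] [DecidableEq ι] (w : ι → F)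
    (C : Matrix ι ι F) : IsUnit (bord (e F ι) (bord w C)).det ↔ IsUnit C.det := by
  rw [isUnit_iff_ne_zero, isUnit_iff_ne_zero, not_iff_not, ← Matrix.exists_mulVec_eq_zero_iff,
    ← Matrix.exists_mulVec_eq_zero_iff]
  constructor
  · rintro ⟨x, hx, h⟩
    have a1 := congrFun h (Sum.inl ())
    have a2 := congrFun h (Sum.inr (Sum.inl ()))
    have a3 := fun i => congrFun h (Sum.inr (Sum.inr i))
    simp [bord, e, mulVec, dotProduct] at a1 a2 a3
    refine ⟨fun i => x (Sum.inr (Sum.inr i)), ?_, ?_⟩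
    · intro h0
      apply hx
      have h0' := fun i => congrFun h0 i
      simp at h0'
      ext i
      rcases i with i | i | i
      · simpa [h0'] using a2
      · exact a1
      · exact h0' i
    · ext i
      simpa [a1, mulVec, dotProduct] using a3 i
  · rintro ⟨z, hz, h⟩
    refine ⟨Sum.elim (fun _ => ∑ i, w i * z i) (Sum.elim (fun _ => 0) z), ?_, ?_⟩
    · intro h0
      apply hz
      ext i
      simpa using congrFun h0 (Sum.inr (Sum.inr i))
    · have h' := fun i => congrFun h i
      simp [mulVec, dotProduct] at h'
      ext i
      rcases i with i | i | i <;> simp [bord, e, mulVec, dotProduct, h']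

lemma card_M_e {F ι : Type*} [Field F] [Fintype F] [Fintype ι] [DecidableEq ι] :
    Nat.card (M (e F ι)) = Fintype.card F ^ Fintype.card ι * Nat.card (T F ι) := by
  classical
  rw [← Fintype.card_fun, ← Nat.card_eq_fintype_card, ← Nat.card_prod]
  refine Nat.card_congr ⟨fun A => (fun j => A.1 (Sum.inl ()) (Sum.inr j),
    ⟨A.1.toBlocks₂₂, ?_, ?_⟩),
    fun p => ⟨bord p.1 p.2.1, (alt_bord _ _).2 p.2.2.1, (unit_bord _ _).2 p.2.2.2⟩, ?_, ?_⟩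
  · rw [← alt_bord, alt_eq_bord _ A.2.1]; exact A.2.1
  · rw [← unit_bord, alt_eq_bord _ A.2.1]; exact A.2.2
  · intro A; exact Subtype.ext (alt_eq_bord _ A.2.1)
  · rintro ⟨v, B, h⟩
    simp [bord]

lemma exists_g {F κ : Type*} [Field F] [Fintype κ] [DecidableEq κ] (v w : κ → F)
    (hv : v ≠ 0) (hw : w ≠ 0) : ∃ g : Matrix κ κ F, IsUnit g.det ∧ g *ᵥ v = w := by
  let f : Submodule.span F {v} ≃ₗ[F] Submodule.span F {w} :=
    (LinearEquiv.toSpanNonzeroSingleton F _ v hv).symm.trans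
      (LinearEquiv.toSpanNonzeroSingleton F _ w hw)
  obtain ⟨g, hg⟩ := Submodule.exists_linearEquiv_restrict_eq f
  refine ⟨LinearMap.toMatrix' (g : (κ → F) →ₗ[F] (κ → F)), ?_, ?_⟩
  · rw [LinearMap.det_toMatrix']
    exact LinearEquiv.isUnit_det' g
  · rw [← Matrix.toLin'_apply, Matrix.toLin'_toMatrix']
    have h1 := hg (LinearEquiv.toSpanNonzeroSingleton F _ v hv 1)
    simp only [f, LinearEquiv.trans_apply, LinearEquiv.symm_apply_apply] at h1
    simpa using h1.symm

lemma step {F ι : Type*} [Field F] [Fintype F] [Fintype ι] [DecidableEq ι] :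
    Nat.card (T F (Unit ⊕ (Unit ⊕ ι))) = (Fintype.card F ^ (Fintype.card ι + 1) - 1) *
      (Fintype.card F ^ Fintype.card ι * Nat.card (T F ι)) := by
  classical
  rw [card_T, ← Finset.add_sum_erase _ _ (Finset.mem_univ 0), card_M_zero, zero_add,
    Finset.sum_const_nat (m := Nat.card (M (e F ι)))]
  · rw [card_M_e, Finset.card_erase_of_mem (Finset.mem_univ _), Finset.card_univ,
      Fintype.card_fun]
    simp [add_comm]
  · intro v hv
    have he : e F ι ≠ 0 := fun h => by simpa [e] using congrFun h (Sum.inl ())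
    obtain ⟨g, hg, rfl⟩ : ∃ g : Matrix _ _ F, IsUnit g.det ∧ g *ᵥ e F ι = v :=
      exists_g _ _ he (Finset.ne_of_mem_erase hv)
    exact (card_M_congr g hg _).symm

lemma card_T_congr {F κ ι : Type*} [Field F] [Fintype κ] [DecidableEq κ] [Fintype ι]
    [DecidableEq ι] (f : κ ≃ ι) : Nat.card (T F κ) = Nat.card (T F ι) := by
  refine Nat.card_congr (Equiv.subtypeEquiv (Matrix.reindex f f) ?_)
  intro A
  rw [Matrix.det_reindex_self]
  refine and_congr ⟨fun h => ⟨?_, fun i => h.2 _⟩, fun h => ⟨?_, fun i => ?_⟩⟩ Iff.rfl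
  · ext i j
    exact congrFun (congrFun h.1 (f.symm i)) (f.symm j)
  · ext i j
    simpa using congrFun (congrFun h.1 (f i)) (f j)
  · simpa using h.2 (f i)

lemma card_T_empty {F : Type*} [Field F] : Nat.card (T F Empty) = 1 := by
  rw [Nat.card_eq_one_iff_unique]
  exact ⟨inferInstance, ⟨⟨0, ⟨by simp, fun i => i.elim⟩, by simp⟩⟩⟩

end AltCount

theorem stmt_0 (F : Type*) [Field F] [Fintype F] (q : ℕ) (hq : Fintype.card F = q) :
    Nat.card {A : Matrix (Fin 6) (Fin 6) F //
      Aᵀ = -A ∧ (∀ i, A i i = 0) ∧ IsUnit A.det} =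
    q ^ 6 * (q ^ 5 - 1) * (q ^ 3 - 1) * (q - 1) := by
  have h0 : Nat.card {A : Matrix (Fin 6) (Fin 6) F //
      Aᵀ = -A ∧ (∀ i, A i i = 0) ∧ IsUnit A.det} = Nat.card (AltCount.T F (Fin 6)) :=
    Nat.card_congr (Equiv.subtypeEquivRight fun A => by simp [AltCount.Alt, and_assoc])
  have f : Fin 6 ≃ Unit ⊕ (Unit ⊕ (Unit ⊕ (Unit ⊕ (Unit ⊕ (Unit ⊕ Empty))))) :=
    Fintype.equivOfCardEq (by simp)
  rw [h0, AltCount.card_T_congr f, AltCount.step, AltCount.step, AltCount.step,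
    AltCount.card_T_empty]
  simp [hq]
  ring
end

section
/- Let F be a finite field with q elements. The number of pairs (A,B) of 3×3 matrices over F with (A,B) ≠ (0,0) such that the adjugate of the matrix X·A + Y·B over the polynomial ring F[X,Y] is the zero matrix (equivalently, all 2×2 minors of X·A + Y·B vanish identically) equals (q³−1)(q²+q+1)(2q³−q+1). -/
lemma fib_card {α β : Type*} [DecidableEq α] [DecidableEq β] (s : Finset α) (f : α → β) (k : ℕ)
    (h : ∀ x ∈ s, (s.filter fun y => f y = f x).card = k) :
    s.card = k * (s.image f).card := by
  rw [Finset.card_eq_sum_card_image f s, Finset.sum_const_nat (m := k), mul_comm]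
  intro b hb
  obtain ⟨x, hx, rfl⟩ := Finset.mem_image.1 hb
  exact h x hx

abbrev PairT (F : Type*) := Matrix (Fin 3) (Fin 3) F × Matrix (Fin 3) (Fin 3) F
abbrev VecT (F : Type*) := Fin 3 → F

lemma pair_eq_iff {F : Type*} (p r : PairT F) :
    p = r ↔ (∀ i j, p.1 i j = r.1 i j) ∧ (∀ i j, p.2 i j = r.2 i j) := by
  constructor
  · rintro rfl
    simp
  · rintro ⟨h1, h2⟩
    exact Prod.ext (Matrix.ext h1) (Matrix.ext h2)

def tens1 {F : Type*} [Field F] (x : VecT F × (VecT F × VecT F)) : PairT F :=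
  (fun i j => x.1 i * x.2.1 j, fun i j => x.1 i * x.2.2 j)
def tens2 {F : Type*} [Field F] (x : VecT F × (VecT F × VecT F)) : PairT F :=
  (fun i j => x.1 j * x.2.1 i, fun i j => x.1 j * x.2.2 i)
def tens3 {F : Type*} [Field F] (x : (F × F) × (VecT F × VecT F)) : PairT F :=
  (fun i j => x.1.1 * x.2.1 i * x.2.2 j, fun i j => x.1.2 * x.2.1 i * x.2.2 j)

section
variable {F : Type*} [Field F]

lemma scal_aux (u a b u' a' b' : VecT F) (hu : u ≠ 0) (hab : (a, b) ≠ 0)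
    (h1 : ∀ i j, u' i * a' j = u i * a j) (h2 : ∀ i j, u' i * b' j = u i * b j) :
    ∃ c : Fˣ, u' = c • u ∧ a' = c⁻¹ • a ∧ b' = c⁻¹ • b := by
  obtain ⟨i, hi⟩ := Function.ne_iff.1 hu
  simp only [Pi.zero_apply] at hi
  have key : u' i ≠ 0 := by
    intro h0
    apply hab
    ext j
    · have := h1 i j
      simp_all
    · have := h2 i j
      simp_all
  have ha : ∀ j, a' j = (u' i / u i)⁻¹ * a j := fun j => by
    have := h1 i j
    field_simp; linear_combination this
  have hb : ∀ j, b' j = (u' i / u i)⁻¹ * b j := fun j => by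
    have := h2 i j
    field_simp; linear_combination this
  have hex : ∃ j, a j ≠ 0 ∨ b j ≠ 0 := by
    by_contra hc
    push Not at hc
    apply hab
    ext j
    · exact (hc j).1
    · exact (hc j).2
  refine ⟨Units.mk0 (u' i / u i) (div_ne_zero key hi), ?_, ?_, ?_⟩
  · ext k
    simp only [Units.smul_def, Units.val_mk0, Pi.smul_apply, smul_eq_mul]
    obtain ⟨j, hj | hj⟩ := hex
    · have e1 := h1 k j
      rw [ha j] at e1
      field_simp at e1 ⊢
      linear_combination e1
    · have e1 := h2 k j
      rw [hb j] at e1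
      field_simp at e1 ⊢
      linear_combination e1
  · ext k
    simp [Units.smul_def, ha k]
  · ext k
    simp [Units.smul_def, hb k]

lemma usmul_zero_iff (c : Fˣ) (u : VecT F) : c • u = 0 ↔ u = 0 := by
  simp [funext_iff, Units.smul_def]

lemma smul_inj_aux (u : VecT F) (hu : u ≠ 0) (c d : Fˣ) (h : c • u = d • u) : c = d := by
  obtain ⟨i, hi⟩ := Function.ne_iff.1 hu
  have := congrFun h i
  simp only [Units.smul_def, Pi.smul_apply, smul_eq_mul] at this
  exact Units.ext (mul_right_cancel₀ hi this)

variable [Fintype F]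

open Classical in
noncomputable def dom1 (F : Type*) [Field F] [Fintype F] : Finset (VecT F × (VecT F × VecT F)) :=
  (Finset.univ.filter fun u : VecT F => u ≠ 0) ×ˢ
    (Finset.univ.filter fun u : VecT F × VecT F => u ≠ 0)

open Classical in
noncomputable def dom3 (F : Type*) [Field F] [Fintype F] : Finset ((F × F) × (VecT F × VecT F)) :=
  (Finset.univ.filter fun u : F × F => u ≠ 0) ×ˢ
   ((Finset.univ.filter fun u : VecT F => u ≠ 0) ×ˢ
    (Finset.univ.filter fun u : VecT F => u ≠ 0))

lemma card_ne_zero_aux (α : Type*) [Zero α] [Fintype α] [DecidablePred fun u : α => u ≠ 0] :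
    (Finset.univ.filter fun u : α => u ≠ 0).card = Fintype.card α - 1 := by
  classical
  rw [show (Finset.univ.filter fun u : α => u ≠ 0) = Finset.univ.erase 0 by ext; simp]
  rw [Finset.card_erase_of_mem (Finset.mem_univ _), Finset.card_univ]

lemma card_dom1 : (dom1 F).card = (Fintype.card F ^ 3 - 1) * (Fintype.card F ^ 6 - 1) := by
  rw [dom1, Finset.card_product, card_ne_zero_aux, card_ne_zero_aux]
  simp only [Fintype.card_prod, Fintype.card_fun, Fintype.card_fin]
  rw [← pow_add]

lemma card_dom3 : (dom3 F).card = (Fintype.card F ^ 2 - 1) *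
    ((Fintype.card F ^ 3 - 1) * (Fintype.card F ^ 3 - 1)) := by
  rw [dom3, Finset.card_product, Finset.card_product, card_ne_zero_aux, card_ne_zero_aux]
  simp only [Fintype.card_prod, Fintype.card_fun, Fintype.card_fin]
  rw [← pow_two]

lemma mem_dom1 (x : VecT F × (VecT F × VecT F)) : x ∈ dom1 F ↔ x.1 ≠ 0 ∧ x.2 ≠ 0 := by
  simp [dom1]

lemma mem_dom3 (x : (F × F) × (VecT F × VecT F)) :
    x ∈ dom3 F ↔ x.1 ≠ 0 ∧ x.2.1 ≠ 0 ∧ x.2.2 ≠ 0 := by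
  simp [dom3]

open Classical in
lemma fib_gen (f : VecT F × (VecT F × VecT F) → PairT F)
    (hf : ∀ x y, f y = f x ↔ (∀ i j, y.1 i * y.2.1 j = x.1 i * x.2.1 j) ∧
      (∀ i j, y.1 i * y.2.2 j = x.1 i * x.2.2 j)) :
    (dom1 F).card = (Fintype.card F - 1) * ((dom1 F).image f).card := by
  apply fib_card
  rintro ⟨u, a, b⟩ hx
  obtain ⟨hu, hab⟩ := (mem_dom1 _).1 hx
  simp only at hu hab
  have : ((dom1 F).filter fun y => f y = f (u, a, b)) =
      (Finset.univ : Finset Fˣ).image (fun c => (c • u, c⁻¹ • a, c⁻¹ • b)) := by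
    ext ⟨u', a', b'⟩
    simp only [Finset.mem_filter, Finset.mem_image, Finset.mem_univ, true_and, mem_dom1, hf]
    constructor
    · rintro ⟨-, h1, h2⟩
      obtain ⟨c, h⟩ := scal_aux u a b u' a' b' hu hab h1 h2
      exact ⟨c, by rw [h.1, h.2.1, h.2.2]⟩
    · rintro ⟨c, h⟩
      simp only [Prod.mk.injEq] at h
      obtain ⟨rfl, rfl, rfl⟩ := h
      refine ⟨⟨by simpa [usmul_zero_iff] using hu, ?_⟩, ?_, ?_⟩
      · simpa [usmul_zero_iff] using hab
      · intro i j
        simp [Units.smul_def]; field_simp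
      · intro i j
        simp [Units.smul_def]; field_simp
  rw [this, Finset.card_image_of_injective, Finset.card_univ, Fintype.card_units]
  intro c d h
  simp only [Prod.mk.injEq] at h
  exact smul_inj_aux u hu c d h.1

open Classical in
lemma fib1 : (dom1 F).card = (Fintype.card F - 1) * ((dom1 F).image tens1).card := by
  apply fib_gen
  intro x y
  simp only [pair_eq_iff, tens1]

open Classical in
lemma fib2 : (dom1 F).card = (Fintype.card F - 1) * ((dom1 F).image tens2).card := by
  apply fib_gen
  intro x y
  simp only [pair_eq_iff, tens2]
  constructor
  · exact fun h => ⟨fun i j => h.1 j i, fun i j => h.2 j i⟩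
  · exact fun h => ⟨fun i j => h.1 j i, fun i j => h.2 j i⟩

open Classical in
lemma fib3 : (dom3 F).card = (Fintype.card F - 1) ^ 2 * ((dom3 F).image tens3).card := by
  apply fib_card
  rintro ⟨⟨s, t⟩, u, v⟩ hx
  obtain ⟨hs, hu, hv⟩ := (mem_dom3 _).1 hx
  simp only at hs hu hv
  have : ((dom3 F).filter fun y => tens3 y = tens3 ((s, t), u, v)) =
      (Finset.univ : Finset (Fˣ × Fˣ)).image
        (fun c => (((c.1 * c.2)⁻¹ • s, (c.1 * c.2)⁻¹ • t), c.1 • u, c.2 • v)) := by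
    ext ⟨⟨s', t'⟩, u', v'⟩
    simp only [Finset.mem_filter, Finset.mem_image, Finset.mem_univ, true_and, mem_dom3,
      pair_eq_iff]
    simp only [tens3, Prod.mk.injEq, funext_iff]
    constructor
    · rintro ⟨⟨hs', hu', hv'⟩, h1, h2⟩
      obtain ⟨j, hj⟩ := Function.ne_iff.1 hv
      simp only [Pi.zero_apply] at hj
      have hab : (s • v, t • v) ≠ 0 := by
        intro h
        apply hs
        have e1 := congrFun (congrArg Prod.fst h) j
        have e2 := congrFun (congrArg Prod.snd h) j
        ext
        · simpa [hj] using e1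
        · simpa [hj] using e2
      obtain ⟨c, hc1, hc2, hc3⟩ := scal_aux u (s • v) (t • v) u' (s' • v') (t' • v') hu hab
        (fun i j => by simp only [Pi.smul_apply, smul_eq_mul]; linear_combination h1 i j)
        (fun i j => by simp only [Pi.smul_apply, smul_eq_mul]; linear_combination h2 i j)
      have g1 : ∀ k, s' * v' k = (c : F)⁻¹ * (s * v k) := fun k => by
        simpa [Units.smul_def] using congrFun hc2 k
      have g2 : ∀ k, t' * v' k = (c : F)⁻¹ * (t * v k) := fun k => by
        simpa [Units.smul_def] using congrFun hc3 k
      have hcc : (c : F) ≠ 0 := c.ne_zero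
      have hst : s ≠ 0 ∨ t ≠ 0 := by
        by_contra hcon
        push Not at hcon
        exact hs (Prod.ext hcon.1 hcon.2)
      have hvj : v' j ≠ 0 := by
        intro h0
        have e1 := g1 j
        have e2 := g2 j
        simp [h0, hj] at e1 e2
        tauto
      refine ⟨(c, Units.mk0 (v' j / v j) (div_ne_zero hvj hj)), ?_⟩
      have es : s' = ((c : F) * (v' j / v j))⁻¹ * s := by
        have e1 := g1 j
        field_simp at e1 ⊢
        linear_combination e1
      have et : t' = ((c : F) * (v' j / v j))⁻¹ * t := by
        have e1 := g2 j
        field_simp at e1 ⊢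
        linear_combination e1
      refine ⟨⟨?_, ?_⟩, ?_, ?_⟩
      · simp [Units.smul_def, es]
      · simp [Units.smul_def, et]
      · intro k
        rw [hc1]
      · intro k
        simp only [Units.smul_def, Units.val_mk0, Pi.smul_apply, smul_eq_mul]
        rcases hst with h | h
        · have e1 := g1 k
          rw [es] at e1
          field_simp at e1 ⊢
          linear_combination -e1
        · have e1 := g2 k
          rw [et] at e1
          field_simp at e1 ⊢
          linear_combination -e1
    · rintro ⟨⟨c, d⟩, ⟨e1, e2⟩, e3, e4⟩
      obtain rfl := funext e3
      obtain rfl := funext e4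
      subst e1 e2
      refine ⟨⟨?_, ?_, ?_⟩, ?_, ?_⟩
      · intro h
        apply hs
        simp only [Prod.mk_eq_zero, smul_eq_zero_iff_eq] at h
        exact Prod.ext h.1 h.2
      · simpa [usmul_zero_iff] using hu
      · simpa [usmul_zero_iff] using hv
      · intro i j
        simp [Units.smul_def]; field_simp
      · intro i j
        simp [Units.smul_def]; field_simp
  rw [this, Finset.card_image_of_injective, Finset.card_univ, Fintype.card_prod,
    Fintype.card_units, pow_two]
  rintro ⟨c, d⟩ ⟨c', d'⟩ h
  simp only [Prod.mk.injEq] at h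
  exact Prod.ext (smul_inj_aux u hu _ _ h.2.1) (smul_inj_aux v hv _ _ h.2.2)

open Classical in
lemma inter_eq : (dom1 F).image tens1 ∩ (dom1 F).image tens2 = (dom3 F).image tens3 := by
  ext p
  simp only [Finset.mem_inter, Finset.mem_image, mem_dom1, mem_dom3]
  constructor
  · rintro ⟨⟨⟨u, a, b⟩, ⟨hu, hab⟩, rfl⟩, ⟨⟨v, a', b'⟩, ⟨hv, hab'⟩, h⟩⟩
    rw [pair_eq_iff] at h
    simp only [tens1, tens2] at h hu hv hab hab' ⊢
    obtain ⟨h1, h2⟩ := h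
    obtain ⟨i, hi⟩ := Function.ne_iff.1 hu
    simp only [Pi.zero_apply] at hi
    have ea : ∀ j, a j = a' i / u i * v j := fun j => by
      have := h1 i j
      field_simp; linear_combination -this
    have eb : ∀ j, b j = b' i / u i * v j := fun j => by
      have := h2 i j
      field_simp; linear_combination -this
    refine ⟨((a' i / u i, b' i / u i), u, v), ⟨?_, hu, hv⟩, ?_⟩
    · intro h0
      have z1 := congrArg Prod.fst h0
      have z2 := congrArg Prod.snd h0
      simp only [Prod.fst_zero, Prod.snd_zero] at z1 z2
      apply hab
      ext j
      · simp [ea, z1]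
      · simp [eb, z2]
    · simp only [pair_eq_iff, tens3]
      exact ⟨fun i j => by rw [ea]; ring, fun i j => by rw [eb]; ring⟩
  · rintro ⟨⟨⟨s, t⟩, u, v⟩, ⟨hs, hu, hv⟩, rfl⟩
    simp only at hs hu hv
    have gen : ∀ w : VecT F, w ≠ 0 → (s • w, t • w) ≠ 0 := by
      intro w hw h
      simp only [Prod.mk_eq_zero, smul_eq_zero, hw, or_false] at h
      exact hs (Prod.ext h.1 h.2)
    refine ⟨⟨(u, s • v, t • v), ⟨hu, gen v hv⟩, ?_⟩, ⟨(v, s • u, t • u), ⟨hv, gen u hu⟩, ?_⟩⟩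
    · simp only [pair_eq_iff, tens1, tens3, Pi.smul_apply, smul_eq_mul]
      exact ⟨fun i j => by ring, fun i j => by ring⟩
    · simp only [pair_eq_iff, tens2, tens3, Pi.smul_apply, smul_eq_mul]
      exact ⟨fun i j => by ring, fun i j => by ring⟩
end

section
variable {F : Type*} [Field F]

/-- all 2×2 minors from the adjugate -/
lemma minors_of_adj {R : Type*} [CommRing R] (M : Matrix (Fin 3) (Fin 3) R) (h : M.adjugate = 0)
    (i k j l : Fin 3) : M i j * M k l = M i l * M k j := by
  rw [Matrix.adjugate_fin_three] at h
  have h' := fun a b => congrFun (congrFun h a) b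
  have h00 := h' 0 0
  have h01 := h' 0 1
  have h02 := h' 0 2
  have h10 := h' 1 0
  have h11 := h' 1 1
  have h12 := h' 1 2
  have h20 := h' 2 0
  have h21 := h' 2 1
  have h22 := h' 2 2
  simp at h00 h01 h02 h10 h11 h12 h20 h21 h22
  have lt3 : ∀ i k : Fin 3, i < k → (i = 0 ∧ k = 1) ∨ (i = 0 ∧ k = 2) ∨ (i = 1 ∧ k = 2) := by
    decide
  have key : ∀ i k j l : Fin 3, i < k → j < l → M i j * M k l = M i l * M k j := by
    intro i k j l hik hjl
    rcases lt3 i k hik with ⟨rfl, rfl⟩ | ⟨rfl, rfl⟩ | ⟨rfl, rfl⟩ <;>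
    rcases lt3 j l hjl with ⟨rfl, rfl⟩ | ⟨rfl, rfl⟩ | ⟨rfl, rfl⟩
    · linear_combination h22
    · linear_combination -h12
    · linear_combination h02
    · linear_combination -h21
    · linear_combination h11
    · linear_combination -h01
    · linear_combination h20
    · linear_combination -h10
    · linear_combination h00
  rcases lt_trichotomy i k with h1 | h1 | h1
  · rcases lt_trichotomy j l with h2 | h2 | h2
    · exact key i k j l h1 h2
    · rw [h2]
    · exact (key i k l j h1 h2).symm
  · rw [h1]; ring
  · rcases lt_trichotomy j l with h2 | h2 | h2
    · linear_combination -key k i j l h1 h2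
    · rw [h2]
    · linear_combination key k i l j h1 h2

lemma adj_of_minors {R : Type*} [CommRing R] (M : Matrix (Fin 3) (Fin 3) R)
    (h : ∀ i k j l : Fin 3, M i j * M k l = M i l * M k j) : M.adjugate = 0 := by
  rw [Matrix.adjugate_fin_three]
  ext i j
  fin_cases i <;> fin_cases j <;> simp <;> grind

open MvPolynomial in
lemma adj_iff (A B : Matrix (Fin 3) (Fin 3) F) :
    Matrix.adjugate
        (Matrix.of fun i j =>
          (X 0 : MvPolynomial (Fin 2) F) * C (A i j) + X 1 * C (B i j)) = 0 ↔
    (∀ i k j l, A i j * A k l = A i l * A k j) ∧ (∀ i k j l, B i j * B k l = B i l * B k j) ∧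
    (∀ i k j l, A i j * B k l + B i j * A k l = A i l * B k j + B i l * A k j) := by
  constructor
  · intro h
    have m := minors_of_adj _ h
    have ev : ∀ (x y : F) (i k j l), (x * A i j + y * B i j) * (x * A k l + y * B k l) =
        (x * A i l + y * B i l) * (x * A k j + y * B k j) := fun x y i k j l => by
      simpa using congrArg (eval ![x, y]) (m i k j l)
    have hA : ∀ i k j l, A i j * A k l = A i l * A k j := fun i k j l => by
      simpa using ev 1 0 i k j l
    have hB : ∀ i k j l, B i j * B k l = B i l * B k j := fun i k j l => by
      simpa using ev 0 1 i k j l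
    exact ⟨hA, hB, fun i k j l => by
      linear_combination ev 1 1 i k j l - hA i k j l - hB i k j l⟩
  · rintro ⟨hA, hB, hAB⟩
    apply adj_of_minors
    intro i k j l
    have a := congrArg (C : F → MvPolynomial (Fin 2) F) (hA i k j l)
    have b := congrArg (C : F → MvPolynomial (Fin 2) F) (hB i k j l)
    have c := congrArg (C : F → MvPolynomial (Fin 2) F) (hAB i k j l)
    simp only [map_mul, map_add] at a b c
    simp only [Matrix.of_apply]
    linear_combination X 0 ^ 2 * a + X 1 ^ 2 * b + X 0 * X 1 * c

variable [Fintype F]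

open Classical in
lemma union_iff (p : PairT F) : p ∈ (dom1 F).image tens1 ∪ (dom1 F).image tens2 ↔
    p ≠ 0 ∧ (∀ i k j l, p.1 i j * p.1 k l = p.1 i l * p.1 k j) ∧
      (∀ i k j l, p.2 i j * p.2 k l = p.2 i l * p.2 k j) ∧
    (∀ i k j l, p.1 i j * p.2 k l + p.2 i j * p.1 k l =
      p.1 i l * p.2 k j + p.2 i l * p.1 k j) := by
  simp only [Finset.mem_union, Finset.mem_image, mem_dom1]
  constructor
  · rintro (⟨⟨u, a, b⟩, ⟨hu, hab⟩, rfl⟩ | ⟨⟨u, a, b⟩, ⟨hu, hab⟩, rfl⟩)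
    all_goals
      simp only at hu hab
      refine ⟨?_, ?_⟩
      · intro h
        obtain ⟨i, hi⟩ := Function.ne_iff.1 hu
        simp only [Pi.zero_apply] at hi
        apply hab
        have z1 := congrArg Prod.fst h
        have z2 := congrArg Prod.snd h
        replace z1 := fun i j => congrFun (congrFun z1 i) j
        replace z2 := fun i j => congrFun (congrFun z2 i) j
        simp only [tens1, tens2, Prod.fst_zero, Prod.snd_zero, Matrix.zero_apply] at z1 z2
        ext j
        · first
          | simpa [hi] using z1 i j
          | simpa [hi] using z1 j i
        · first
          | simpa [hi] using z2 i j
          | simpa [hi] using z2 j i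
      · simp only [tens1, tens2]
        refine ⟨?_, ?_, ?_⟩ <;> intros <;> ring
  · obtain ⟨A, B⟩ := p
    rintro ⟨h0, hA, hB, hAB⟩
    simp only at hA hB hAB
    by_cases hA0 : A = 0
    · subst hA0
      have hB0 : B ≠ 0 := fun h => h0 (by rw [h]; rfl)
      obtain ⟨i, hi⟩ := Function.ne_iff.1 hB0
      obtain ⟨j, hj⟩ := Function.ne_iff.1 hi
      replace hj : B i j ≠ 0 := hj
      left
      refine ⟨(fun k => B k j, 0, fun l => B i l / B i j), ⟨?_, ?_⟩, ?_⟩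
      · exact fun h => hj (congrFun h i)
      · intro h
        have := congrFun (congrArg Prod.snd h) j
        simp [hj] at this
      · simp only [pair_eq_iff, tens1]
        refine ⟨fun k l => by simp, fun k l => ?_⟩
        have := hB i k j l
        field_simp
        linear_combination -this
    · obtain ⟨i, hi⟩ := Function.ne_iff.1 hA0
      obtain ⟨j, hj⟩ := Function.ne_iff.1 hi
      replace hj : A i j ≠ 0 := hj
      have hAe : ∀ k l, A k l = A k j * A i l / A i j := fun k l => by
        have := hA i k j l
        field_simp
        linear_combination this
      have hBe : ∀ k l, B k l = (A i l * B k j + B i l * A k j - B i j * A k l) / A i j :=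
        fun k l => by
          have := hAB i k j l
          field_simp
          linear_combination this
      by_cases hx : ∀ k, B k j = B i j * A k j / A i j
      · left
        refine ⟨(fun k => A k j, fun l => A i l / A i j, fun l => B i l / A i j), ⟨?_, ?_⟩, ?_⟩
        · exact fun h => hj (congrFun h i)
        · intro h
          have := congrFun (congrArg Prod.fst h) j
          simp [hj] at this
        · simp only [pair_eq_iff, tens1]
          refine ⟨fun k l => ?_, fun k l => ?_⟩
          · rw [hAe k l]; ring
          · rw [hBe k l, hx k, hAe k l]
            field_simp; ring
      · right
        push Not at hx
        obtain ⟨k, hk⟩ := hx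
        have hk' : B k j * A i j - B i j * A k j ≠ 0 := by
          intro h
          apply hk
          field_simp
          linear_combination h
        have hy : ∀ l, B i l = B i j * A i l / A i j := fun l => by
          have m := hB i k j l
          rw [hBe k l, hAe k l] at m
          have : (B k j * A i j - B i j * A k j) * (B i l * A i j - B i j * A i l) = 0 := by
            field_simp at m
            linear_combination -m
          have := (mul_eq_zero.1 this).resolve_left hk'
          field_simp
          linear_combination this
        refine ⟨(fun l => A i l / A i j, fun k => A k j, fun k => B k j), ⟨?_, ?_⟩, ?_⟩
        · intro h
          have := congrFun h j
          simp [hj] at this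
        · intro h
          exact hj (congrFun (congrArg Prod.fst h) i)
        · simp only [pair_eq_iff, tens2]
          refine ⟨fun k l => ?_, fun k l => ?_⟩
          · rw [hAe k l]; ring
          · rw [hBe k l, hy l, hAe k l]
            field_simp; ring
end

open MvPolynomial in
/-- The number of pairs `(A,B) ≠ (0,0)` of 3×3 matrices over a finite field with `q`
elements such that the adjugate of the pencil `X·A + Y·B` over `F[X,Y]` vanishes
identically equals `(q³−1)(q²+q+1)(2q³−q+1)`. -/
theorem stmt_4 (F : Type*) [Field F] [Fintype F] (q : ℕ) (hq : Fintype.card F = q) :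
    Nat.card {p : Matrix (Fin 3) (Fin 3) F × Matrix (Fin 3) (Fin 3) F //
      p ≠ 0 ∧
      Matrix.adjugate
        (Matrix.of fun i j =>
          (X 0 : MvPolynomial (Fin 2) F) * C (p.1 i j) + X 1 * C (p.2 i j)) = 0} =
    (q ^ 3 - 1) * (q ^ 2 + q + 1) * (2 * q ^ 3 - q + 1) := by
  classical
  have hcard : Nat.card {p : Matrix (Fin 3) (Fin 3) F × Matrix (Fin 3) (Fin 3) F //
      p ≠ 0 ∧
      Matrix.adjugate
        (Matrix.of fun i j =>
          (X 0 : MvPolynomial (Fin 2) F) * C (p.1 i j) + X 1 * C (p.2 i j)) = 0} =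
      ((dom1 F).image tens1 ∪ (dom1 F).image tens2).card := by
    rw [← Nat.card_eq_finsetCard]
    apply Nat.card_congr
    apply Equiv.subtypeEquivRight
    intro p
    rw [union_iff, adj_iff]
  rw [hcard]
  have hu := Finset.card_union_add_card_inter ((dom1 F).image tens1) ((dom1 F).image tens2)
  rw [inter_eq] at hu
  have f1 := fib1 (F := F)
  have f2 := fib2 (F := F)
  have f3 := fib3 (F := F)
  rw [card_dom1] at f1 f2
  rw [card_dom3] at f3
  rw [hq] at f1 f2 f3
  have hq2 : 1 < q := hq ▸ Fintype.one_lt_card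
  generalize ((dom1 F).image tens1 ∪ (dom1 F).image tens2).card = N at *
  generalize ((dom1 F).image tens1).card = a at *
  generalize ((dom1 F).image tens2).card = b at *
  generalize ((dom3 F).image tens3).card = c at *
  obtain ⟨r, rfl⟩ : ∃ r, q = r + 1 := ⟨q - 1, by omega⟩
  have p2 : (r + 1) ^ 2 - 1 = r * (r + 2) := by
    rw [Nat.sub_eq_iff_eq_add (Nat.one_le_pow _ _ (by omega))]; ring
  have p3 : (r + 1) ^ 3 - 1 = r * (r ^ 2 + 3 * r + 3) := by
    rw [Nat.sub_eq_iff_eq_add (Nat.one_le_pow _ _ (by omega))]; ring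
  have p6 : (r + 1) ^ 6 - 1 = r * (r ^ 2 + 3 * r + 3) * ((r + 1) ^ 3 + 1) := by
    rw [Nat.sub_eq_iff_eq_add (Nat.one_le_pow _ _ (by omega))]; ring
  have p7 : 2 * (r + 1) ^ 3 - (r + 1) = 2 * r ^ 3 + 6 * r ^ 2 + 5 * r + 1 := by
    rw [Nat.sub_eq_iff_eq_add (by nlinarith [Nat.zero_le (r ^ 3), Nat.zero_le (r ^ 2)])]; ring
  rw [p3, p6] at f1 f2
  rw [p2, p3] at f3
  rw [p3, p7]
  simp only [Nat.add_sub_cancel] at f1 f2 f3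
  have hr : (r : ℤ) ≠ 0 := by omega
  zify at *
  have : (r : ℤ) ^ 2 ≠ 0 := pow_ne_zero _ hr
  apply mul_left_cancel₀ this
  linear_combination (r : ℤ) ^ 2 * hu - r * f1 - r * f2 + f3
end

section
/- Let F be a finite field with q elements. The number of pairs (A,B) of alternating 6×6 matrices over F with (A,B) ≠ (0,0) such that every 3×3 minor of the matrix X·A + Y·B over the polynomial ring F[X,Y] vanishes equals (q⁵−1)(q⁴+q²+1)(q⁶+q⁵−q²+1). -/
open Matrix MvPolynomial

namespace Pencil

variable {F : Type*} [Field F]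

/-- Alternating matrices. -/
def Alt (A : Matrix (Fin 6) (Fin 6) F) : Prop := Aᵀ = -A ∧ ∀ i, A i i = 0

lemma Alt.swap {A : Matrix (Fin 6) (Fin 6) F} (h : Alt A) (i j : Fin 6) : A j i = - A i j := by
  have := congrFun (congrFun h.1 i) j
  simpa using this

/-- Polarized Plücker relations. -/
def Pl (A B : Matrix (Fin 6) (Fin 6) F) : Prop := ∀ i j k l,
  A i j * B k l + A k l * B i j - A i k * B j l - A j l * B i k + A i l * B j k + A j k * B i l = 0

/-- Plücker relations. -/
def Dec (A : Matrix (Fin 6) (Fin 6) F) : Prop := ∀ i j k l,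
  A i j * A k l - A i k * A j l + A i l * A j k = 0

/-- The wedge `u ∧ v` as a linear map in `v`. -/
def w (u : Fin 6 → F) : (Fin 6 → F) →ₗ[F] Matrix (Fin 6) (Fin 6) F where
  toFun v := Matrix.of fun i j => u i * v j - u j * v i
  map_add' x y := by ext i j; simp; ring
  map_smul' c x := by ext i j; simp; ring

@[simp] lemma w_apply (u v : Fin 6 → F) (i j : Fin 6) : w u v i j = u i * v j - u j * v i := rfl

/-- `u ∧ A = 0`. -/
def K (A : Matrix (Fin 6) (Fin 6) F) (u : Fin 6 → F) : Prop := ∀ i j k,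
  u k * A i j - u i * A k j + u j * A k i = 0

lemma alt_w (u v : Fin 6 → F) : Alt (w u v) := by
  constructor
  · ext i j; simp
  · intro i; simp

lemma dec_w (u v : Fin 6 → F) : Dec (w u v) := by
  intro i j k l; simp; ring

lemma pl_w (u v v' : Fin 6 → F) : Pl (w u v) (w u v') := by
  intro i j k l; simp; ring

lemma exists_ne {A : Matrix (Fin 6) (Fin 6) F} (h : A ≠ 0) : ∃ i j, A i j ≠ 0 := by
  by_contra! h'
  exact h (by ext i j; simpa using h' i j)

lemma K_of_mem {A : Matrix (Fin 6) (Fin 6) F} {u : Fin 6 → F}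
    (h : A ∈ LinearMap.range (w u)) : K A u := by
  obtain ⟨v, rfl⟩ := h
  intro i j k; simp; ring

lemma mem_of_K {A : Matrix (Fin 6) (Fin 6) F} {u : Fin 6 → F} (hu : u ≠ 0)
    (h : K A u) : A ∈ LinearMap.range (w u) := by
  obtain ⟨k, hk⟩ := Function.ne_iff.mp hu
  simp only [Pi.zero_apply] at hk
  refine ⟨fun j => (u k)⁻¹ * A k j, ?_⟩
  ext i j
  have := h i j k
  simp only [w_apply]
  field_simp
  linear_combination -this

lemma mem_iff {A : Matrix (Fin 6) (Fin 6) F} {u : Fin 6 → F} (hu : u ≠ 0) :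
    A ∈ LinearMap.range (w u) ↔ K A u := ⟨K_of_mem, mem_of_K hu⟩

lemma exists_w {A : Matrix (Fin 6) (Fin 6) F} (hd : Dec A) (h : A ≠ 0) :
    ∃ u v, A = w u v := by
  obtain ⟨i, j, hij⟩ := exists_ne h
  refine ⟨fun k => (A i j)⁻¹ * A i k, fun k => A j k, ?_⟩
  ext k l
  have := hd i j k l
  simp only [w_apply]
  field_simp
  linear_combination this

lemma w_eq_zero {u v : Fin 6 → F} (hu : u ≠ 0) (h : w u v = 0) : ∃ c : F, c • u = v := by
  obtain ⟨k, hk⟩ := Function.ne_iff.mp hu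
  simp only [Pi.zero_apply] at hk
  refine ⟨(u k)⁻¹ * v k, ?_⟩
  ext l
  have := congrFun (congrFun h k) l
  simp at this ⊢
  field_simp
  linear_combination -this

lemma ker_w {u : Fin 6 → F} (hu : u ≠ 0) : LinearMap.ker (w u) = Submodule.span F {u} := by
  ext v
  rw [LinearMap.mem_ker, Submodule.mem_span_singleton]
  constructor
  · exact w_eq_zero hu
  · rintro ⟨c, rfl⟩
    ext i j; simp; ring

lemma finrank_L {u : Fin 6 → F} (hu : u ≠ 0) : Module.finrank F (LinearMap.range (w u)) = 5 := by
  have := LinearMap.finrank_range_add_finrank_ker (w u)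
  rw [ker_w hu, finrank_span_singleton hu] at this
  simp at this
  exact this

lemma K_of_line {A : Matrix (Fin 6) (Fin 6) F} (hd : Dec A) {i j : Fin 6}
    (x y : F) : K A (fun k => x * A k j - y * A k i) := by
  intro a b c
  have h1 := hd c a b j
  have h2 := hd c a b i
  simp only
  linear_combination x * h1 - y * h2

/-- the kernel of a decomposable `A` is a plane. -/
noncomputable def KEquiv {A : Matrix (Fin 6) (Fin 6) F} (hA : Alt A) (hd : Dec A) {i j : Fin 6}
    (hij : A i j ≠ 0) : {u // K A u} ≃ F × F where
  toFun u := (u.1 i, u.1 j)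
  invFun x := ⟨fun k => (x.1 * (A i j)⁻¹) * A k j - (x.2 * (A i j)⁻¹) * A k i, K_of_line hd _ _⟩
  left_inv u := by
    ext k
    have := u.2 i j k
    simp only
    field_simp
    linear_combination -this
  right_inv x := by
    have h1 := hA.2 i
    have h2 := hA.2 j
    have h3 := hA.swap i j
    ext
    · simp [h1, hij]
    · simp [h2, h3, hij]

lemma w_of_K {A : Matrix (Fin 6) (Fin 6) F} (hd : Dec A) (h : A ≠ 0)
    {u v : Fin 6 → F} (hu : K A u) (hv : K A v) : ∃ c : F, w u v = c • A := by
  obtain ⟨i, j, hij⟩ := exists_ne h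
  refine ⟨(u i * v j - u j * v i) * (A i j)⁻¹, ?_⟩
  ext k l
  have hd := hd k l i j
  have u1 := hu i j k
  have u2 := hu i j l
  have v1 := hv i j k
  have v2 := hv i j l
  simp only [w_apply, Matrix.smul_apply, smul_eq_mul]
  field_simp
  apply mul_left_cancel₀ hij
  linear_combination (A i j * v l) * u1 + (u i * A k j - u j * A k i) * v2 - (A i j * v k) * u2
    - (u i * A l j - u j * A l i) * v1 - (u i * v j - u j * v i) * hd

lemma exists_common {A B : Matrix (Fin 6) (Fin 6) F} (hdA : Dec A) (h : A ≠ 0)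
    (hdB : Dec B) (h' : B ≠ 0) (hp : Pl A B) : ∃ u, u ≠ 0 ∧ K A u ∧ K B u := by
  obtain ⟨u, v, rfl⟩ := exists_w hdA h
  obtain ⟨p, r, hpr⟩ := exists_ne h'
  have key : ∀ z : Fin 6 → F, (∀ k, z k * B p r - z p * B k r + z r * B k p = 0) → K B z := by
    intro z hz
    have : z = fun k => (z p * (B p r)⁻¹) * B k r - (z r * (B p r)⁻¹) * B k p := by
      ext k
      have := hz k
      field_simp
      linear_combination this
    rw [this]
    exact K_of_line hdB _ _
  by_cases hu : ∀ k, u k * B p r - u p * B k r + u r * B k p = 0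
  · refine ⟨u, ?_, K_of_mem ⟨v, rfl⟩, key u hu⟩
    rintro rfl
    apply h
    ext i j; simp
  · push Not at hu
    obtain ⟨k, hk⟩ := hu
    set c := u k * B p r - u p * B k r + u r * B k p with hc
    set d := v k * B p r - v p * B k r + v r * B k p with hd
    refine ⟨c • v - d • u, ?_, ?_, ?_⟩
    · intro h0
      have : w u (c • v - d • u) = 0 := by rw [h0]; simp
      have h2 : w u (c • v - d • u) = c • w u v := by
        ext i j; simp; ring
      rw [h2] at this
      rcases smul_eq_zero.mp this with h3 | h3
      · exact hk h3
      · exact h h3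
    · intro a b e; simp; ring
    · apply key
      intro l
      have h1 := hp k l p r
      have h2 := hdB k l p r
      simp only [w_apply] at h1
      simp only [Pi.sub_apply, Pi.smul_apply, smul_eq_mul, hc, hd]
      linear_combination B p r * h1 - (u p * v r - u r * v p) * h2

section minors

lemma minor_of_dec {R : Type*} [CommRing R] {M : Matrix (Fin 6) (Fin 6) R}
    (hd : ∀ i j k l, M i j * M k l - M i k * M j l + M i l * M j k = 0)
    (f g : Fin 3 → Fin 6) : (M.submatrix f g).det = 0 := by
  rw [Matrix.det_fin_three]
  simp only [Matrix.submatrix_apply]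
  have h1 := hd (f 1) (f 2) (g 1) (g 2)
  have h2 := hd (f 1) (f 2) (g 0) (g 2)
  have h3 := hd (f 1) (f 2) (g 0) (g 1)
  have h4 := hd (f 0) (g 0) (g 1) (g 2)
  linear_combination M (f 1) (f 2) * h4 - M (f 0) (g 0) * h1 + M (f 0) (g 1) * h2
    - M (f 0) (g 2) * h3

lemma dec_of_minor {A : Matrix (Fin 6) (Fin 6) F} (hA : Alt A)
    (h : ∀ f g : Fin 3 → Fin 6, (A.submatrix f g).det = 0) : Dec A := by
  have key : ∀ i j k l, A i j * (A i j * A k l - A i k * A j l + A i l * A j k) = 0 := by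
    intro i j k l
    have := h ![i, j, k] ![i, j, l]
    rw [Matrix.det_fin_three] at this
    simp [hA.2] at this
    rw [hA.swap i j, hA.swap i k, hA.swap j k] at this
    linear_combination this
  intro i j k l
  by_contra hne
  have h1 : A i j = 0 := (mul_eq_zero.mp (key i j k l)).resolve_right hne
  have h2 : A i k = 0 := by
    refine (mul_eq_zero.mp (key i k j l)).resolve_right fun h0 => hne ?_
    rw [hA.swap j k] at h0
    linear_combination -h0
  have h3 : A i l = 0 := by
    refine (mul_eq_zero.mp (key i l j k)).resolve_right fun h0 => hne ?_
    rw [hA.swap k l, hA.swap j l] at h0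
    linear_combination h0
  apply hne
  rw [h1, h2, h3]; ring

lemma minors_iff {A B : Matrix (Fin 6) (Fin 6) F} (hA : Alt A) (hB : Alt B) :
    (∀ f g : Fin 3 → Fin 6,
        Matrix.det
          ((Matrix.of fun i j =>
              (X 0 : MvPolynomial (Fin 2) F) * C (A i j) +
                (X 1 : MvPolynomial (Fin 2) F) * C (B i j)).submatrix f g) = 0) ↔
    (Dec A ∧ Dec B ∧ Pl A B) := by
  constructor
  · intro h
    have ev : ∀ x y : F, Dec (x • A + y • B) := by
      intro x y
      apply dec_of_minor
      · constructor
        · rw [Matrix.transpose_add, Matrix.transpose_smul, Matrix.transpose_smul, hA.1, hB.1]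
          ext i j; simp; ring
        · intro i; simp [hA.2, hB.2]
      · intro f g
        have := congrArg (MvPolynomial.eval ![x, y]) (h f g)
        rw [RingHom.map_det, map_zero] at this
        rw [← this]
        congr 1
        ext i j
        simp
    have e1 := ev 1 0
    have e2 := ev 0 1
    have e3 := ev 1 1
    simp only [one_smul, zero_smul, add_zero, zero_add] at e1 e2 e3
    refine ⟨e1, e2, ?_⟩
    intro i j k l
    have h1 := e1 i j k l
    have h2 := e2 i j k l
    have h3 := e3 i j k l
    simp only [Matrix.add_apply] at h3
    linear_combination h3 - h1 - h2
  · rintro ⟨h1, h2, h3⟩ f g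
    apply minor_of_dec
    intro i j k l
    have h1 := congrArg (C : F → MvPolynomial (Fin 2) F) (h1 i j k l)
    have h2 := congrArg (C : F → MvPolynomial (Fin 2) F) (h2 i j k l)
    have h3 := congrArg (C : F → MvPolynomial (Fin 2) F) (h3 i j k l)
    simp only [map_add, map_sub, map_mul, map_zero] at h1 h2 h3
    simp only [Matrix.of_apply]
    linear_combination (X 0) ^ 2 * h1 + (X 1) ^ 2 * h2 + X 0 * X 1 * h3

end minors

section counting

open Classical Finset

lemma card_fib {α β : Type*} [Fintype α] [Fintype β] (P : α → Prop) (Q : α → β → Prop) (n : ℕ)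
    (h : ∀ a, P a → #{b | Q a b} = n) :
    #{p : α × β | P p.1 ∧ Q p.1 p.2} = #{a | P a} * n := by
  rw [Finset.card_eq_sum_card_fiberwise (f := Prod.fst) (t := ({a | P a} : Finset α))]
  · rw [Finset.sum_const_nat]
    intro a ha
    simp only [Finset.mem_filter, Finset.mem_univ, true_and] at ha
    rw [← h a ha]
    symm
    apply Finset.card_bij (fun b _ => (a, b))
    · intro b hb; simp at hb ⊢; exact ⟨ha, hb⟩
    · intro b _ b' _ h; simpa using h
    · rintro ⟨a', b⟩ hb
      simp at hb
      obtain ⟨⟨h1, h2⟩, rfl⟩ := hb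
      exact ⟨b, by simpa using h2, rfl⟩
  · intro p hp
    simp at hp ⊢
    exact hp.1

lemma dec_smul {A : Matrix (Fin 6) (Fin 6) F} (hA : Dec A) (c : F) : Dec (c • A) := by
  intro i j k l
  simp only [Matrix.smul_apply, smul_eq_mul]
  linear_combination c ^ 2 * hA i j k l

lemma pl_smul {A : Matrix (Fin 6) (Fin 6) F} (hA : Dec A) (c : F) : Pl A (c • A) := by
  intro i j k l
  simp only [Matrix.smul_apply, smul_eq_mul]
  linear_combination 2 * c * hA i j k l

lemma alt_smul {A : Matrix (Fin 6) (Fin 6) F} (hA : Alt A) (c : F) : Alt (c • A) := by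
  refine ⟨?_, fun i => by simp [hA.2]⟩
  rw [Matrix.transpose_smul, hA.1, smul_neg]

variable [Fintype F]

lemma card_sub {V : Type*} [AddCommGroup V] [Module F V] [Fintype V] (S : Submodule F V) :
    #{x | x ∈ S} = Fintype.card F ^ Module.finrank F S := by
  rw [← Module.card_eq_pow_finrank (K := F) (V := S), Fintype.card_subtype]

lemma card_sdiff {V : Type*} [AddCommGroup V] [Module F V] [Fintype V] (S T : Submodule F V)
    (h : T ≤ S) :
    #{x | x ∈ S ∧ x ∉ T} = Fintype.card F ^ Module.finrank F S
      - Fintype.card F ^ Module.finrank F T := by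
  rw [← card_sub, ← card_sub, ← Finset.card_sdiff_of_subset]
  · congr 1; ext x; simp
  · intro x; simpa using @h x

lemma card_ne {V : Type*} [AddCommGroup V] [Module F V] [Fintype V] (S : Submodule F V) :
    #{x | x ∈ S ∧ x ≠ 0} = Fintype.card F ^ Module.finrank F S - 1 := by
  have := card_sdiff S ⊥ bot_le
  simpa using this

lemma card_u : #{u : Fin 6 → F | u ≠ 0} = Fintype.card F ^ 6 - 1 := by
  have := card_ne (⊤ : Submodule F (Fin 6 → F))
  simpa using this

variable (F) in
/-- number of rank two alternating matrices -/
noncomputable def N : ℕ := #{A : Matrix (Fin 6) (Fin 6) F | (Alt A ∧ Dec A) ∧ A ≠ 0}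

lemma card_N : N F * (Fintype.card F ^ 2 - 1) =
    (Fintype.card F ^ 6 - 1) * (Fintype.card F ^ 5 - 1) := by
  rw [← card_u, N]
  apply Finset.card_mul_eq_card_mul (fun A u => A ∈ LinearMap.range (w u))
  · intro A hA
    simp only [Finset.mem_filter, Finset.mem_univ, true_and] at hA
    obtain ⟨⟨hA, hd⟩, h0⟩ := hA
    obtain ⟨i, j, hij⟩ := exists_ne h0
    have hc := Fintype.card_congr (KEquiv hA hd hij)
    rw [Fintype.card_prod, Fintype.card_subtype] at hc
    rw [sq, ← hc, ← Finset.card_erase_of_mem (a := 0)]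
    · congr 1
      ext u
      simp only [Finset.bipartiteAbove, Finset.mem_filter, Finset.mem_univ, true_and,
        Finset.mem_erase]
      constructor
      · rintro ⟨h1, h2⟩
        exact ⟨h1, (mem_iff h1).1 h2⟩
      · rintro ⟨h1, h2⟩
        exact ⟨h1, (mem_iff h1).2 h2⟩
    · simp only [Finset.mem_filter, Finset.mem_univ, true_and]
      intro i j k; simp
  · intro u hu
    simp only [Finset.mem_filter, Finset.mem_univ, true_and] at hu
    rw [← finrank_L hu, ← card_ne]
    congr 1
    ext A
    simp only [Finset.bipartiteBelow, Finset.mem_filter, Finset.mem_univ, true_and]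
    constructor
    · rintro ⟨h1, h2⟩
      exact ⟨h2, h1.2⟩
    · rintro ⟨⟨v, rfl⟩, h2⟩
      exact ⟨⟨⟨alt_w _ _, dec_w _ _⟩, h2⟩, ⟨v, rfl⟩⟩

/-- pairs spanning a line -/
abbrev P2 (p : Matrix (Fin 6) (Fin 6) F × Matrix (Fin 6) (Fin 6) F) : Prop :=
  ((Alt p.1 ∧ Dec p.1) ∧ p.1 ≠ 0) ∧ (Alt p.2 ∧ Dec p.2 ∧ Pl p.1 p.2) ∧
    p.2 ∉ Submodule.span F {p.1}

lemma card_S2 : #{p : Matrix (Fin 6) (Fin 6) F × Matrix (Fin 6) (Fin 6) F | P2 p} *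
    (Fintype.card F - 1) =
    (Fintype.card F ^ 6 - 1) * ((Fintype.card F ^ 5 - 1) * (Fintype.card F ^ 5 - Fintype.card F)) := by
  rw [← card_u]
  apply Finset.card_mul_eq_card_mul
    (fun p u => p.1 ∈ LinearMap.range (w u) ∧ p.2 ∈ LinearMap.range (w u))
  · rintro ⟨A, B⟩ hp
    simp only [P2, Finset.mem_filter, Finset.mem_univ, true_and] at hp
    obtain ⟨⟨⟨hA, hdA⟩, hA0⟩, ⟨hB, hdB, hpl⟩, hB0⟩ := hp
    have hB1 : B ≠ 0 := by
      rintro rfl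
      exact hB0 (Submodule.zero_mem _)
    obtain ⟨u, hu, huA, huB⟩ := exists_common hdA hA0 hdB hB1 hpl
    have := card_ne (Submodule.span F {u})
    rw [finrank_span_singleton hu, pow_one] at this
    rw [← this]
    congr 1
    ext v
    simp only [Finset.bipartiteAbove, Finset.mem_filter, Finset.mem_univ, true_and,
      Submodule.mem_span_singleton]
    constructor
    · rintro ⟨h0, h1, h2⟩
      refine ⟨?_, h0⟩
      apply w_eq_zero hu
      by_contra hne
      obtain ⟨c, hc⟩ := w_of_K hdA hA0 huA (K_of_mem h1)
      obtain ⟨d, hd⟩ := w_of_K hdB hB1 huB (K_of_mem h2)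
      apply hB0
      rw [Submodule.mem_span_singleton]
      have hd0 : d ≠ 0 := by
        rintro rfl
        exact hne (by rw [hd, zero_smul])
      refine ⟨d⁻¹ * c, ?_⟩
      rw [mul_smul, ← hc, hd, smul_smul, inv_mul_cancel₀ hd0, one_smul]
    · rintro ⟨⟨c, rfl⟩, h0⟩
      refine ⟨h0, mem_of_K h0 ?_, mem_of_K h0 ?_⟩
      · intro i j k
        simp only [Pi.smul_apply, smul_eq_mul]
        linear_combination c * huA i j k
      · intro i j k
        simp only [Pi.smul_apply, smul_eq_mul]
        linear_combination c * huB i j k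
  · intro u hu
    simp only [Finset.mem_filter, Finset.mem_univ, true_and] at hu
    have hf := card_fib (fun A => A ∈ LinearMap.range (w u) ∧ A ≠ 0)
      (fun A B => B ∈ LinearMap.range (w u) ∧ B ∉ Submodule.span F {A})
      (Fintype.card F ^ 5 - Fintype.card F) (by
        rintro A ⟨h1, h2⟩
        have := card_sdiff _ _ ((Submodule.span_singleton_le_iff_mem _ _).2 h1)
        rw [finrank_span_singleton h2, pow_one, finrank_L hu] at this
        rw [← this]
        congr!)
    have hn := card_ne (LinearMap.range (w u))
    rw [finrank_L hu] at hn
    rw [← hn]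
    refine Eq.trans ?_ (hf.trans ?_)
    · congr 1
      ext ⟨A, B⟩
      simp only [P2, Finset.bipartiteBelow, Finset.mem_filter, Finset.mem_univ, true_and]
      constructor
      · rintro ⟨⟨h1, h2, h3⟩, h4, h5⟩
        exact ⟨⟨h4, h1.2⟩, h5, h3⟩
      · rintro ⟨⟨⟨v, rfl⟩, h2⟩, ⟨v', rfl⟩, h3⟩
        exact ⟨⟨⟨⟨alt_w _ _, dec_w _ _⟩, h2⟩, ⟨alt_w _ _, dec_w _ _, pl_w _ _ _⟩, h3⟩,
          ⟨v, rfl⟩, ⟨v', rfl⟩⟩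
    · congr!

lemma card_total : #{p : Matrix (Fin 6) (Fin 6) F × Matrix (Fin 6) (Fin 6) F |
      Alt p.1 ∧ Alt p.2 ∧ p ≠ 0 ∧ Dec p.1 ∧ Dec p.2 ∧ Pl p.1 p.2} =
    N F + N F * Fintype.card F + #{p : Matrix (Fin 6) (Fin 6) F × Matrix (Fin 6) (Fin 6) F | P2 p} := by
  have h1 := card_fib (fun A : Matrix (Fin 6) (Fin 6) F => A = 0)
    (fun _ B : Matrix (Fin 6) (Fin 6) F => (Alt B ∧ Dec B) ∧ B ≠ 0) (N F) (fun _ _ => by unfold N; congr!)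
  have h2 := card_fib (fun A : Matrix (Fin 6) (Fin 6) F => (Alt A ∧ Dec A) ∧ A ≠ 0)
    (fun A B : Matrix (Fin 6) (Fin 6) F => B ∈ Submodule.span F {A}) (Fintype.card F) (by
      rintro A ⟨_, hA⟩
      rw [card_sub, finrank_span_singleton hA, pow_one])
  replace h1 := h1.trans (show _ = N F by
    rw [Finset.card_eq_one.2 ⟨0, by ext; simp⟩, one_mul])
  replace h2 := h2.trans (show _ = N F * Fintype.card F by unfold N; congr!)
  rw [← h2]
  nth_rewrite 1 [← h1]
  rw [← Finset.card_union_of_disjoint, ← Finset.card_union_of_disjoint]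
  · congr 1
    ext ⟨A, B⟩
    simp only [P2, Finset.mem_filter, Finset.mem_univ, true_and, Finset.mem_union, ne_eq,
      Prod.mk_eq_zero]
    constructor
    · rintro ⟨h1, h2, h3, h4, h5, h6⟩
      tauto
    · rintro ((⟨rfl, h1⟩ | ⟨h1, h2⟩) | h)
      · refine ⟨⟨by simp, by simp⟩, h1.1.1, by tauto, ?_, h1.1.2, ?_⟩
        · intro i j k l; simp
        · intro i j k l; simp
      · obtain ⟨c, rfl⟩ := Submodule.mem_span_singleton.1 h2
        exact ⟨h1.1.1, alt_smul h1.1.1 c, by tauto, h1.1.2, dec_smul h1.1.2 c, pl_smul h1.1.2 c⟩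
      · tauto
  · rw [Finset.disjoint_left]
    rintro ⟨A, B⟩ h h'
    simp only [P2, Finset.mem_filter, Finset.mem_univ, true_and, Finset.mem_union] at h h'
    tauto
  · rw [Finset.disjoint_left]
    rintro ⟨A, B⟩ h h'
    simp only [Finset.mem_filter, Finset.mem_univ, true_and] at h h'
    tauto

lemma arith (q n s : ℕ) (hq : 2 ≤ q) (h1 : n * (q ^ 2 - 1) = (q ^ 6 - 1) * (q ^ 5 - 1))
    (h2 : s * (q - 1) = (q ^ 6 - 1) * ((q ^ 5 - 1) * (q ^ 5 - q))) :
    n + n * q + s = (q ^ 5 - 1) * (q ^ 4 + q ^ 2 + 1) * (q ^ 6 + q ^ 5 - q ^ 2 + 1) := by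
  have p2 : 1 ≤ q ^ 2 := Nat.one_le_pow _ _ (by omega)
  have p5 : 1 ≤ q ^ 5 := Nat.one_le_pow _ _ (by omega)
  have p6 : 1 ≤ q ^ 6 := Nat.one_le_pow _ _ (by omega)
  have p51 : q ≤ q ^ 5 := Nat.le_self_pow (by norm_num) q
  have p62 : q ^ 2 ≤ q ^ 6 + q ^ 5 :=
    (Nat.pow_le_pow_right (by omega) (by norm_num : 2 ≤ 6)).trans (Nat.le_add_right _ _)
  zify [p2, p5, p6, p51, p62, (by omega : 1 ≤ q)] at h1 h2 ⊢
  have hq' : (2 : ℤ) ≤ q := by exact_mod_cast hq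
  have hn : (n : ℤ) = (q ^ 5 - 1) * (q ^ 4 + q ^ 2 + 1) := by
    apply mul_right_cancel₀ (b := (q : ℤ) ^ 2 - 1) (by nlinarith)
    rw [h1]; ring
  have hs : (s : ℤ) = (q ^ 5 - 1) * (q ^ 4 + q ^ 2 + 1) * ((q + 1) * (q ^ 5 - q)) := by
    apply mul_right_cancel₀ (b := (q : ℤ) - 1) (by linarith)
    rw [h2]; ring
  rw [hn, hs]; ring

end counting

end Pencil

/-- The number of pairs `(A,B) ≠ (0,0)` of alternating 6×6 matrices over a finite field
with `q` elements such that every 3×3 minor of the pencil `X·A + Y·B` over `F[X,Y]`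
vanishes equals `(q⁵−1)(q⁴+q²+1)(q⁶+q⁵−q²+1)`. -/
theorem stmt_5 (F : Type*) [Field F] [Fintype F] (q : ℕ) (hq : Fintype.card F = q) :
    Nat.card {p : Matrix (Fin 6) (Fin 6) F × Matrix (Fin 6) (Fin 6) F //
      (p.1ᵀ = -p.1 ∧ ∀ i, p.1 i i = 0) ∧
      (p.2ᵀ = -p.2 ∧ ∀ i, p.2 i i = 0) ∧
      p ≠ 0 ∧
      ∀ f g : Fin 3 → Fin 6,
        Matrix.det
          ((Matrix.of fun i j =>
              (X 0 : MvPolynomial (Fin 2) F) * C (p.1 i j) +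
                (X 1 : MvPolynomial (Fin 2) F) * C (p.2 i j)).submatrix f g) = 0} =
    (q ^ 5 - 1) * (q ^ 4 + q ^ 2 + 1) * (q ^ 6 + q ^ 5 - q ^ 2 + 1) := by
  classical
  have h := Pencil.card_total (F := F)
  have h1 := Pencil.card_N (F := F)
  have h2 := Pencil.card_S2 (F := F)
  rw [hq] at h h1 h2
  have hq2 : 2 ≤ q := hq ▸ Fintype.one_lt_card
  rw [← Pencil.arith q _ _ hq2 h1 h2, ← h, Nat.card_eq_fintype_card, Fintype.card_subtype]
  congr 1
  ext ⟨A, B⟩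
  simp only [Finset.mem_filter, Finset.mem_univ, true_and]
  constructor
  · rintro ⟨hA, hB, h0, hm⟩
    exact ⟨hA, hB, h0, (Pencil.minors_iff hA hB).1 hm⟩
  · rintro ⟨hA, hB, h0, hm⟩
    exact ⟨hA, hB, h0, (Pencil.minors_iff hA hB).2 hm⟩
end

section
/- Let F be a finite field with q elements. The number of 2-dimensional F-linear subspaces P of the third exterior power ⋀³(F⁶) such that every element of P is decomposable equals (q²+q+1)²(q²−q+1)(q²+1)(q⁴+q³+q²+q+1). -/
namespace Stmt6
open Module

variable {F : Type*} [Field F] {V : Type*} [AddCommGroup V] [Module F V]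

theorem alt_prop {N : Type*} [AddCommGroup N] [Module F N] {n : ℕ} (f : V [⋀^Fin n]→ₗ[F] N)
    (w u : Fin n → V) (hu : ∀ i, u i ∈ Submodule.span F (Set.range w)) :
    ∃ c : F, f u = c • f w := by
  classical
  have h1 : ∀ i, ∃ c : Fin n → F, ∑ j, c j • w j = u i := fun i =>
    (Submodule.mem_span_range_iff_exists_fun F).1 (hu i)
  choose M hM using h1
  let φ : (Fin n → F) →ₗ[F] V := Fintype.linearCombination F w
  have hφ : ∀ x, φ x = ∑ j, x j • w j := fun x => by simp [φ, Fintype.linearCombination_apply]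
  let g := f.compLinearMap φ
  let e := Pi.basisFun F (Fin n)
  let g' : (Fin n → F) [⋀^Fin n]→ₗ[F] N :=
    (LinearMap.toSpanSingleton F N (g e)).compAlternatingMap e.det
  have hgg : g = g' := by
    refine Basis.ext_alternating e ?_
    intro v hv
    let σ : Equiv.Perm (Fin n) := Equiv.ofBijective v (Finite.injective_iff_bijective.1 hv)
    have : (fun i => e (v i)) = ⇑e ∘ σ := rfl
    rw [this, AlternatingMap.map_perm, AlternatingMap.map_perm]
    congr 1
    simp [g', Basis.det_self]
  have hge : g e = f w := by
    simp only [g, AlternatingMap.compLinearMap_apply]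
    congr 1
    ext i
    simp [hφ, e, Pi.single_apply]
  refine ⟨e.det M, ?_⟩
  have h2 : f u = g M := by
    simp only [g, AlternatingMap.compLinearMap_apply]
    congr 1
    ext i
    rw [hφ, hM]
  rw [h2, hgg]
  simp [g', hge]

theorem wedge_ne_zero {n : ℕ} {w : Fin n → V} (hw : LinearIndependent F w) :
    ExteriorAlgebra.ιMulti F n w ≠ 0 := by
  have h := exteriorPower.ιMulti_family_linearIndependent_field (n := n) hw
  let s : Set.powersetCard (Fin n) n := ⟨Finset.univ, by simp [Set.powersetCard]⟩
  have h2 := h.ne_zero s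
  intro h0
  apply h2
  apply Subtype.ext
  rw [exteriorPower.ιMulti_family_apply_coe]
  simp only [ExteriorAlgebra.ιMulti_family]
  obtain ⟨c, hc⟩ := alt_prop (ExteriorAlgebra.ιMulti F n) w
    (w ∘ (Set.powersetCard.ofFinEmbEquiv.symm s))
    (fun i => Submodule.subset_span ⟨_, rfl⟩)
  rw [hc, h0]; simp

theorem li_of_wedge {n : ℕ} {w : Fin n → V} (hw : ExteriorAlgebra.ιMulti F n w ≠ 0) :
    LinearIndependent F w := by
  by_contra h
  exact hw (AlternatingMap.map_linearDependent _ _ h)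

theorem ann_iff {n : ℕ} {w : Fin n → V} (hw : LinearIndependent F w) (v : V) :
    ExteriorAlgebra.ι F v * ExteriorAlgebra.ιMulti F n w = 0 ↔
      v ∈ Submodule.span F (Set.range w) := by
  have : ExteriorAlgebra.ι F v * ExteriorAlgebra.ιMulti F n w
      = ExteriorAlgebra.ιMulti F (n+1) (Fin.cons v w) := by
    rw [ExteriorAlgebra.ιMulti_succ_apply]; rfl
  rw [this]
  constructor
  · intro h
    by_contra hv
    exact wedge_ne_zero (linearIndependent_finCons.2 ⟨hw, hv⟩) h
  · intro h
    by_contra h2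
    exact (linearIndependent_finCons.1 (li_of_wedge h2)).2 h

/-- the trivector -/
noncomputable def T (a b c : V) : ⋀[F]^3 V := exteriorPower.ιMulti F 3 ![a, b, c]

variable (F) in
/-- the span of three -/
def S3 (a b c : V) : Submodule F V := Submodule.span F (Set.range ![a, b, c])

theorem mem_S3 {a b c v : V} : v ∈ S3 F a b c ↔ ∃ x y z : F, x • a + y • b + z • c = v := by
  unfold S3
  rw [Submodule.mem_span_range_iff_exists_fun]
  constructor
  · rintro ⟨f, h⟩
    exact ⟨f 0, f 1, f 2, by simpa [Fin.sum_univ_three] using h⟩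
  · rintro ⟨x, y, z, h⟩
    exact ⟨![x, y, z], by simpa [Fin.sum_univ_three] using h⟩

theorem T_coe (a b c : V) : ((T a b c : ⋀[F]^3 V) : ExteriorAlgebra F V) =
    ExteriorAlgebra.ιMulti F 3 ![a, b, c] := rfl

theorem T_lin (a b c d : V) (x y : F) : (T a b (x • c + y • d) : ⋀[F]^3 V) =
    x • T a b c + y • T a b d := by
  have h : ∀ c : V, ![a, b, c] = Function.update ![a, b, 0] 2 c := by
    intro c; ext i; fin_cases i <;> rfl
  unfold T
  rw [h, h c, h d, AlternatingMap.map_update_add, AlternatingMap.map_update_smul,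
    AlternatingMap.map_update_smul]

theorem T_ne_zero {a b c : V} (h : LinearIndependent F ![a, b, c]) : (T a b c : ⋀[F]^3 V) ≠ 0 := by
  intro h0
  apply wedge_ne_zero h
  rw [← T_coe, h0]; rfl

theorem li_of_T {a b c : V} (h : (T a b c : ⋀[F]^3 V) ≠ 0) : LinearIndependent F ![a, b, c] := by
  apply li_of_wedge
  intro h0
  apply h
  apply Subtype.ext
  rw [T_coe, h0]; rfl

theorem T_prop {a b c a' b' c' : V} (ha : a' ∈ S3 F a b c) (hb : b' ∈ S3 F a b c)
    (hc : c' ∈ S3 F a b c) : ∃ k : F, (T a' b' c' : ⋀[F]^3 V) = k • T a b c := by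
  apply alt_prop
  intro i
  fin_cases i
  exacts [ha, hb, hc]

/-- v kills ω -/
def Ann (v : V) (ω : ⋀[F]^3 V) : Prop :=
  ExteriorAlgebra.ι F v * (ω : ExteriorAlgebra F V) = 0

theorem ann_T {a b c : V} (h : LinearIndependent F ![a, b, c]) (v : V) :
    Ann v (T a b c : ⋀[F]^3 V) ↔ v ∈ S3 F a b c := ann_iff h v

/-- pencil -/
noncomputable def Pen (a b c d : V) : Submodule F (⋀[F]^3 V) :=
  Submodule.span F {T a b c, T a b d}

theorem mem_Pen {a b c d : V} {ω : ⋀[F]^3 V} :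
    ω ∈ Pen a b c d ↔ ∃ x y : F, T a b (x • c + y • d) = ω := by
  unfold Pen
  rw [Submodule.mem_span_pair]
  simp only [T_lin]

theorem li4_iff {a b c d : V} : LinearIndependent F ![a, b, c, d] ↔
    ∀ x y z t : F, x • a + y • b + z • c + t • d = 0 → x = 0 ∧ y = 0 ∧ z = 0 ∧ t = 0 := by
  rw [Fintype.linearIndependent_iff]
  constructor
  · intro h x y z t h0
    have := h ![x, y, z, t] (by simpa [Fin.sum_univ_four] using h0)
    exact ⟨this 0, this 1, this 2, this 3⟩
  · intro h g hg
    obtain ⟨h0, h1, h2, h3⟩ := h (g 0) (g 1) (g 2) (g 3) (by simpa [Fin.sum_univ_four] using hg)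
    intro i; fin_cases i <;> assumption

theorem li3_iff {a b c : V} : LinearIndependent F ![a, b, c] ↔
    ∀ x y z : F, x • a + y • b + z • c = 0 → x = 0 ∧ y = 0 ∧ z = 0 := by
  rw [Fintype.linearIndependent_iff]
  constructor
  · intro h x y z h0
    have := h ![x, y, z] (by simpa [Fin.sum_univ_three] using h0)
    exact ⟨this 0, this 1, this 2⟩
  · intro h g hg
    obtain ⟨h0, h1, h2⟩ := h (g 0) (g 1) (g 2) (by simpa [Fin.sum_univ_three] using hg)
    intro i; fin_cases i <;> assumption

theorem li_comb {a b c d : V} (h : LinearIndependent F ![a, b, c, d]) {x y : F}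
    (hxy : ¬ (x = 0 ∧ y = 0)) : LinearIndependent F ![a, b, x • c + y • d] := by
  rw [li4_iff] at h
  rw [li3_iff]
  intro p r s h0
  obtain ⟨h1, h2, h3, h4⟩ := h p r (s * x) (s * y) (by rw [← h0]; module)
  have : s = 0 := by
    by_contra hs
    exact hxy ⟨by simpa [hs] using h3, by simpa [hs] using h4⟩
  exact ⟨h1, h2, this⟩

theorem li_Ts {a b c d : V} (h : LinearIndependent F ![a, b, c, d]) :
    LinearIndependent F ![(T a b c : ⋀[F]^3 V), T a b d] := by
  rw [LinearIndependent.pair_iff]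
  intro x y h0
  by_contra hxy
  rw [← T_lin] at h0
  exact T_ne_zero (li_comb h hxy) h0

theorem finrank_Pen {a b c d : V} (h : LinearIndependent F ![a, b, c, d]) :
    finrank F (Pen a b c d : Submodule F (⋀[F]^3 V)) = 2 := by
  have := finrank_span_eq_card (li_Ts h)
  rw [Matrix.range_cons_cons_empty] at this
  exact this

/-- flags determined by the pencil, first step -/
theorem flag_low {a b c d v : V} (h : LinearIndependent F ![a, b, c, d])
    (hv : ∀ ω ∈ (Pen a b c d : Submodule F (⋀[F]^3 V)), Ann v ω) :
    ∃ x y : F, v = x • a + y • b := by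
  have h1 : v ∈ S3 F a b c := by
    have := li_comb h (x := 1) (y := 0) (by simp)
    simp only [one_smul, zero_smul, add_zero] at this
    exact (ann_T this v).1 (hv _ (Submodule.subset_span (by simp)))
  have h2 : v ∈ S3 F a b d := by
    have := li_comb h (x := 0) (y := 1) (by simp)
    simp only [one_smul, zero_smul, zero_add] at this
    exact (ann_T this v).1 (hv _ (Submodule.subset_span (by simp)))
  obtain ⟨x, y, z, hx⟩ := mem_S3.1 h1
  obtain ⟨x', y', z', hx'⟩ := mem_S3.1 h2
  obtain ⟨-, -, h3, -⟩ := li4_iff.1 h (x - x') (y - y') z (-z') (by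
    have := sub_eq_zero.2 (hx.trans hx'.symm)
    rw [← this]; module)
  refine ⟨x, y, ?_⟩
  rw [← hx, h3]; module

theorem ann_Pen {a b c d v : V} (h : LinearIndependent F ![a, b, c, d])
    (hv : v = a ∨ v = b) (ω) (hω : ω ∈ (Pen a b c d : Submodule F (⋀[F]^3 V))) : Ann v ω := by
  obtain ⟨x, y, rfl⟩ := mem_Pen.1 hω
  by_cases hxy : x = 0 ∧ y = 0
  · obtain ⟨rfl, rfl⟩ := hxy
    rw [T_lin]; simp [Ann]
  · rw [ann_T (li_comb h hxy), mem_S3]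
    rcases hv with rfl | rfl
    · exact ⟨1, 0, 0, by module⟩
    · exact ⟨0, 1, 0, by module⟩

theorem flag_high {a b c d a' b' c' : V} (h' : LinearIndependent F ![a', b', c'])
    (hm : T a' b' c' ∈ (Pen a b c d : Submodule F (⋀[F]^3 V))) :
    ∃ x y z t : F, c' = x • a + y • b + z • c + t • d := by
  obtain ⟨x, y, hT⟩ := mem_Pen.1 hm
  have hli : LinearIndependent F ![a, b, x • c + y • d] := by
    apply li_of_T
    rw [hT]; exact T_ne_zero h'
  have : Ann c' (T a b (x • c + y • d) : ⋀[F]^3 V) := by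
    rw [hT, ann_T h', mem_S3]
    exact ⟨0, 0, 1, by module⟩
  rw [ann_T hli, mem_S3] at this
  obtain ⟨p, r, s, rfl⟩ := this
  exact ⟨p, r, s * x, s * y, by module⟩

theorem T_mem_Pen {a b c d a' b' c' : V} (ha : ∃ x y : F, a' = x • a + y • b)
    (hb : ∃ x y : F, b' = x • a + y • b)
    (hc : ∃ x y z t : F, c' = x • a + y • b + z • c + t • d) :
    T a' b' c' ∈ (Pen a b c d : Submodule F (⋀[F]^3 V)) := by
  obtain ⟨x1, y1, rfl⟩ := ha
  obtain ⟨x2, y2, rfl⟩ := hb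
  obtain ⟨x, y, z, t, rfl⟩ := hc
  obtain ⟨k, hk⟩ := T_prop (F := F) (a := a) (b := b) (c := z • c + t • d)
    (mem_S3.2 ⟨x1, y1, 0, rfl⟩) (mem_S3.2 ⟨x2, y2, 0, rfl⟩) (mem_S3.2 ⟨x, y, 1, rfl⟩)
  rw [mem_Pen]
  refine ⟨k * z, k * t, ?_⟩
  rw [T_lin] at hk ⊢
  have e1 : x1 • a + y1 • b + (0 : F) • (z • c + t • d) = x1 • a + y1 • b := by module
  have e2 : x2 • a + y2 • b + (0 : F) • (z • c + t • d) = x2 • a + y2 • b := by module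
  have e3 : x • a + y • b + (1 : F) • (z • c + t • d) = x • a + y • b + z • c + t • d := by module
  rw [e1, e2, e3] at hk
  rw [hk]; module

theorem finrank_S3 {a b c : V} (h : LinearIndependent F ![a, b, c]) :
    finrank F (S3 F a b c) = 3 := by
  exact finrank_span_eq_card h

theorem S3_ext [FiniteDimensional F V] {a b c : V} {U : Submodule F V}
    (h : LinearIndependent F ![a, b, c])
    (hU : finrank F U = 3) (ha : a ∈ U) (hb : b ∈ U) (hc : c ∈ U) : S3 F a b c = U := by
  apply Submodule.eq_of_le_of_finrank_eq
  · unfold S3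
    rw [Submodule.span_le]
    rintro _ ⟨i, rfl⟩
    fin_cases i
    exacts [ha, hb, hc]
  · rw [finrank_S3 h, hU]

theorem S3_mem1 {a b c : V} : a ∈ S3 F a b c := mem_S3.2 ⟨1, 0, 0, by module⟩
theorem S3_mem2 {a b c : V} : b ∈ S3 F a b c := mem_S3.2 ⟨0, 1, 0, by module⟩
theorem S3_mem3 {a b c : V} : c ∈ S3 F a b c := mem_S3.2 ⟨0, 0, 1, by module⟩

theorem li_extend {a b c : V} {A : Submodule F V} (h : LinearIndependent F ![a, b])
    (ha : a ∈ A) (hb : b ∈ A) (hc : c ∉ A) : LinearIndependent F ![a, b, c] := by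
  rw [LinearIndependent.pair_iff] at h
  rw [li3_iff]
  intro x y z h0
  have hz : z = 0 := by
    by_contra hz
    apply hc
    have : c = (-z⁻¹ * x) • a + (-z⁻¹ * y) • b := by
      have h1 : z⁻¹ • (x • a + y • b + z • c) = 0 := by rw [h0, smul_zero]
      have h2 : z⁻¹ • z • c = c := by rw [smul_smul, inv_mul_cancel₀ hz, one_smul]
      rw [smul_add, h2] at h1
      rw [eq_neg_of_add_eq_zero_right h1]
      module
    rw [this]
    exact A.add_mem (A.smul_mem _ ha) (A.smul_mem _ hb)
  subst hz
  rw [zero_smul, add_zero] at h0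
  obtain ⟨rfl, rfl⟩ := h x y h0
  simp

theorem li_extend4 {a b c d : V} (h : LinearIndependent F ![a, b, c])
    (hd : d ∉ S3 F a b c) : LinearIndependent F ![a, b, c, d] := by
  rw [li3_iff] at h
  rw [li4_iff]
  intro x y z t h0
  have hz : t = 0 := by
    by_contra hz
    apply hd
    rw [mem_S3]
    refine ⟨-t⁻¹ * x, -t⁻¹ * y, -t⁻¹ * z, ?_⟩
    have h1 : t⁻¹ • (x • a + y • b + z • c + t • d) = 0 := by rw [h0, smul_zero]
    have h2 : t⁻¹ • t • d = d := by rw [smul_smul, inv_mul_cancel₀ hz, one_smul]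
    rw [smul_add, h2] at h1
    rw [eq_neg_of_add_eq_zero_right h1]
    module
  subst hz
  rw [zero_smul, add_zero] at h0
  obtain ⟨rfl, rfl, rfl⟩ := h x y z h0
  simp

theorem exists_two {P : Submodule F V} (h2 : finrank F P = 2) :
    ∃ a ∈ P, ∃ b ∈ P, LinearIndependent F ![a, b] ∧ P = Submodule.span F {a, b} := by
  have : Module.Finite F P := Module.finite_of_finrank_eq_succ h2
  let B := finBasisOfFinrankEq F P h2
  refine ⟨B 0, (B 0).2, B 1, (B 1).2, ?_, ?_⟩
  · rw [LinearIndependent.pair_iff]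
    intro x y h
    have hB := Fintype.linearIndependent_iff.1 B.linearIndependent ![x, y] (by
      apply Subtype.ext
      simpa [Fin.sum_univ_two] using h)
    exact ⟨hB 0, hB 1⟩
  · apply le_antisymm
    · intro ω hω
      have hs := B.sum_repr ⟨ω, hω⟩
      rw [Fin.sum_univ_two] at hs
      rw [Submodule.mem_span_pair]
      exact ⟨_, _, congrArg Subtype.val hs⟩
    · rw [Submodule.span_le]
      rintro _ (rfl | rfl)
      exacts [(B 0).2, (B 1).2]

theorem exists_pencil [FiniteDimensional F V] (P : Submodule F (⋀[F]^3 V))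
    (h2 : finrank F P = 2) (hP : ∀ ω ∈ P, ∃ a b c : V, ω = T a b c) :
    ∃ a b c d : V, LinearIndependent F ![a, b, c, d] ∧ Pen a b c d = P := by
  obtain ⟨ω₁, hm1, ω₂, hm2, hli, hspan⟩ := exists_two h2
  rw [LinearIndependent.pair_iff] at hli
  obtain ⟨a1, a2, a3, ha⟩ := hP ω₁ hm1
  obtain ⟨b1, b2, b3, hb⟩ := hP ω₂ hm2
  obtain ⟨c1, c2, c3, hc⟩ := hP (ω₁ + ω₂) (P.add_mem hm1 hm2)
  have ha0 : LinearIndependent F ![a1, a2, a3] := by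
    apply li_of_T
    rw [← ha]
    intro h
    have := hli 1 0 (by rw [h]; simp)
    simp at this
  have hb0 : LinearIndependent F ![b1, b2, b3] := by
    apply li_of_T
    rw [← hb]
    intro h
    have := hli 0 1 (by rw [h]; simp)
    simp at this
  have hc0 : LinearIndependent F ![c1, c2, c3] := by
    apply li_of_T
    rw [← hc]
    intro h
    have := hli 1 1 (by simpa using h)
    simp at this
  -- an element of `U₃` outside `U₁`
  have hv : ∃ v ∈ S3 F c1 c2 c3, v ∉ S3 F a1 a2 a3 := by
    by_contra! hcon
    obtain ⟨k, hk⟩ := T_prop (F := F) (hcon _ S3_mem1) (hcon _ S3_mem2) (hcon _ S3_mem3)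
    rw [← hc, ← ha] at hk
    have := hli (1 - k) 1 (by
      have := sub_eq_zero.2 hk
      rw [← this]; module)
    simp at this
  obtain ⟨v, hv3, hv1⟩ := hv
  rw [← ann_T hc0, ← hc] at hv3
  have hWli : LinearIndependent F (Fin.cons v ![a1, a2, a3] : Fin 4 → V) :=
    linearIndependent_finCons.2 ⟨ha0, hv1⟩
  set W := Submodule.span F (Set.range (Fin.cons v ![a1, a2, a3] : Fin 4 → V)) with hW
  have hWr : finrank F W = 4 := by
    have := finrank_span_eq_card hWli
    simpa using this
  have hWe : ExteriorAlgebra.ιMulti F 4 (Fin.cons v ![a1, a2, a3] : Fin 4 → V) =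
      ExteriorAlgebra.ι F v * (ω₁ : ExteriorAlgebra F V) := by
    rw [ExteriorAlgebra.ιMulti_succ_apply, ha]; rfl
  have hvv : ExteriorAlgebra.ι F v * (ω₁ : ExteriorAlgebra F V) =
      - (ExteriorAlgebra.ι F v * (ω₂ : ExteriorAlgebra F V)) := by
    unfold Ann at hv3
    rw [Submodule.coe_add, mul_add] at hv3
    exact eq_neg_of_add_eq_zero_left hv3
  have key : ∀ u, Ann u ω₁ ∨ Ann u ω₂ → u ∈ W := by
    intro u hu
    rw [hW, ← ann_iff hWli, hWe]
    have hsw : ExteriorAlgebra.ι F u * ExteriorAlgebra.ι F v =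
      - (ExteriorAlgebra.ι F v * ExteriorAlgebra.ι F u) :=
      eq_neg_of_add_eq_zero_left (ExteriorAlgebra.ι_add_mul_swap u v)
    unfold Ann at hu
    rcases hu with hu | hu
    · rw [← mul_assoc, hsw, neg_mul, mul_assoc, hu]; simp
    · rw [hvv, mul_neg, ← mul_assoc, hsw, neg_mul, mul_assoc, hu]; simp
  set U₁ := S3 F a1 a2 a3 with hU₁
  set U₂ := S3 F b1 b2 b3 with hU₂
  have hU1r : finrank F U₁ = 3 := finrank_S3 ha0
  have hU2r : finrank F U₂ = 3 := finrank_S3 hb0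
  have hsup : U₁ ⊔ U₂ ≤ W := by
    apply sup_le
    · intro u hu
      rw [hU₁, ← ann_T ha0, ← ha] at hu
      exact key u (Or.inl hu)
    · intro u hu
      rw [hU₂, ← ann_T hb0, ← hb] at hu
      exact key u (Or.inr hu)
  have hne : ¬ U₁ ≤ U₂ := by
    intro h
    obtain ⟨k, hk⟩ := T_prop (F := F) (h S3_mem1) (h S3_mem2) (h S3_mem3)
    rw [← hb, ← ha] at hk
    have := hli 1 (-k) (by rw [hk]; module)
    simp at this
  have hne' : ¬ U₂ ≤ U₁ := by
    intro h
    exact hne (Submodule.eq_of_le_of_finrank_eq h (by rw [hU1r, hU2r])).ge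
  have hinf : finrank F (U₁ ⊓ U₂ : Submodule F V) = 2 := by
    have e1 := Submodule.finrank_sup_add_finrank_inf_eq U₁ U₂
    have e2 := Submodule.finrank_mono hsup
    have e3 : finrank F (U₁ ⊓ U₂ : Submodule F V) < finrank F U₁ :=
      Submodule.finrank_lt_finrank_of_lt (inf_lt_left.2 hne)
    omega
  obtain ⟨a, h0m, b, h1m, hab, -⟩ := exists_two hinf
  obtain ⟨c, hcU, hcn⟩ := SetLike.not_le_iff_exists.1 hne
  obtain ⟨d, hdU, hdn⟩ := SetLike.not_le_iff_exists.1 hne'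
  have habc : LinearIndependent F ![a, b, c] := li_extend hab h0m h1m (fun h => hcn h.2)
  have habd : LinearIndependent F ![a, b, d] := li_extend hab h0m h1m (fun h => hdn h.1)
  have hE1 : S3 F a b c = U₁ := S3_ext habc hU1r h0m.1 h1m.1 hcU
  have hE2 : S3 F a b d = U₂ := S3_ext habd hU2r h0m.2 h1m.2 hdU
  have h4 : LinearIndependent F ![a, b, c, d] := li_extend4 habc (by rw [hE1]; exact hdn)
  refine ⟨a, b, c, d, h4, ?_⟩
  symm
  apply Submodule.eq_of_le_of_finrank_eq
  · obtain ⟨k1, hk1⟩ : ∃ k : F, (T a1 a2 a3 : ⋀[F]^3 V) = k • T a b c := by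
      apply T_prop <;> rw [hE1]
      exacts [S3_mem1, S3_mem2, S3_mem3]
    obtain ⟨k2, hk2⟩ : ∃ k : F, (T b1 b2 b3 : ⋀[F]^3 V) = k • T a b d := by
      apply T_prop <;> rw [hE2]
      exacts [S3_mem1, S3_mem2, S3_mem3]
    rw [hspan, Submodule.span_le]
    rintro _ (rfl | rfl)
    · rw [ha, hk1]
      exact Submodule.smul_mem _ _ (Submodule.subset_span (by simp))
    · rw [hb, hk2]
      exact Submodule.smul_mem _ _ (Submodule.subset_span (by simp))
  · rw [h2, finrank_Pen h4]

/-- index type of the tuples -/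
abbrev J := Fin 2 ⊕ Fin 2

theorem li_J {s : J → V} : LinearIndependent F s ↔
    LinearIndependent F ![s (.inl 0), s (.inl 1), s (.inr 0), s (.inr 1)] := by
  rw [li4_iff, Fintype.linearIndependent_iff]
  simp only [Fintype.sum_sum_type, Fin.sum_univ_two]
  constructor
  · intro h x y z t h0
    have := h (Sum.elim ![x, y] ![z, t]) (by rw [← h0]; simp [add_assoc])
    exact ⟨this (.inl 0), this (.inl 1), this (.inr 0), this (.inr 1)⟩
  · intro h g hg
    obtain ⟨h0, h1, h2, h3⟩ := h _ _ _ _ ((add_assoc _ _ _).trans hg)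
    rintro (i | i) <;> fin_cases i <;> assumption

/-- the pencil of a tuple -/
noncomputable def PenS (s : J → V) : Submodule F (⋀[F]^3 V) :=
  Pen (s (.inl 0)) (s (.inl 1)) (s (.inr 0)) (s (.inr 1))

/-- the matrix action on tuples -/
def act (M : Matrix J J F) (s : J → V) : J → V := fun i => ∑ j, M i j • s j

theorem sum_act (M : Matrix J J F) (s : J → V) (w : J → F) :
    ∑ i, w i • act M s i = ∑ j, (Matrix.vecMul w M) j • s j := by
  simp only [act, Matrix.vecMul, dotProduct, Finset.smul_sum, Finset.sum_smul, smul_smul]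
  rw [Finset.sum_comm]

theorem li_act_iff (M : Matrix J J F) {s : J → V} (hs : LinearIndependent F s) :
    LinearIndependent F (act M s) ↔ M.det ≠ 0 := by
  rw [Fintype.linearIndependent_iff] at hs ⊢
  simp only [sum_act]
  constructor
  · intro h h0
    obtain ⟨w, hw, hw0⟩ := Matrix.exists_vecMul_eq_zero_iff.2 h0
    exact hw (funext (h w (by simp [hw0])))
  · intro h w hw
    have := Matrix.eq_zero_of_vecMul_eq_zero h (funext (hs _ hw))
    exact fun i => congrFun this i

theorem act_inj {M M' : Matrix J J F} {s : J → V} (hs : LinearIndependent F s)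
    (h : act M s = act M' s) : M = M' := by
  rw [Fintype.linearIndependent_iff] at hs
  ext i j
  have := hs (fun j => M i j - M' i j) (by
    have := congrFun h i
    simp only [act] at this
    simp [sub_smul, this])
  exact sub_eq_zero.1 (this j)

theorem PenS_act_le (X Y Z : Matrix (Fin 2) (Fin 2) F) (s : J → V) :
    (PenS (act (Matrix.fromBlocks X 0 Y Z) s) : Submodule F (⋀[F]^3 V)) ≤ PenS s := by
  unfold PenS
  conv_lhs => unfold Pen
  rw [Submodule.span_le]
  have hl : ∀ i, ∃ x y : F, act (Matrix.fromBlocks X 0 Y Z) s (.inl i) =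
      x • s (.inl 0) + y • s (.inl 1) := fun i => ⟨X i 0, X i 1, by simp [act]⟩
  have hr : ∀ i, ∃ x y z t : F, act (Matrix.fromBlocks X 0 Y Z) s (.inr i) =
      x • s (.inl 0) + y • s (.inl 1) + z • s (.inr 0) + t • s (.inr 1) :=
    fun i => ⟨Y i 0, Y i 1, Z i 0, Z i 1, by simp [act, add_assoc]⟩
  rintro _ (rfl | rfl)
  · exact T_mem_Pen (hl 0) (hl 1) (hr 0)
  · exact T_mem_Pen (hl 0) (hl 1) (hr 1)

theorem PenS_finrank {s : J → V} (hs : LinearIndependent F s) :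
    finrank F (PenS s : Submodule F (⋀[F]^3 V)) = 2 := finrank_Pen (li_J.1 hs)

theorem PenS_act [FiniteDimensional F V] (X Y Z : Matrix (Fin 2) (Fin 2) F) {s : J → V}
    (hs : LinearIndependent F s)
    (hs' : LinearIndependent F (act (Matrix.fromBlocks X 0 Y Z) s)) :
    (PenS (act (Matrix.fromBlocks X 0 Y Z) s) : Submodule F (⋀[F]^3 V)) = PenS s := by
  apply Submodule.eq_of_le_of_finrank_eq (PenS_act_le X Y Z s)
  rw [PenS_finrank hs, PenS_finrank hs']

theorem exists_act {s s' : J → V} (hs : LinearIndependent F s) (hs' : LinearIndependent F s')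
    (h : (PenS s' : Submodule F (⋀[F]^3 V)) = PenS s) :
    ∃ X Y Z : Matrix (Fin 2) (Fin 2) F, s' = act (Matrix.fromBlocks X 0 Y Z) s := by
  have h4 := li_J.1 hs
  have h4' := li_J.1 hs'
  unfold PenS at h
  have hl : ∀ i, ∃ x y : F, s' (.inl i) = x • s (.inl 0) + y • s (.inl 1) := by
    intro i
    apply flag_low h4
    rw [← h]
    apply ann_Pen h4'
    fin_cases i <;> simp
  have hr : ∀ i, ∃ x y z t : F, s' (.inr i) =
      x • s (.inl 0) + y • s (.inl 1) + z • s (.inr 0) + t • s (.inr 1) := by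
    intro i
    fin_cases i
    · have := li_comb h4' (x := 1) (y := 0) (by simp)
      simp only [one_smul, zero_smul, add_zero] at this
      apply flag_high this
      rw [← h]
      exact Submodule.subset_span (by simp)
    · have := li_comb h4' (x := 0) (y := 1) (by simp)
      simp only [one_smul, zero_smul, zero_add] at this
      apply flag_high this
      rw [← h]
      exact Submodule.subset_span (by simp)
  choose x0 x1 hx using hl
  choose y0 y1 z0 z1 hy using hr
  refine ⟨Matrix.of fun i => ![x0 i, x1 i], Matrix.of fun i => ![y0 i, y1 i],
    Matrix.of fun i => ![z0 i, z1 i], ?_⟩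
  funext i
  rcases i with i | i
  · rw [hx]; simp [act]
  · rw [hy]; simp [act, add_assoc]

/-- the fibres of the pencil map -/
theorem card_fiber [Fintype F] [FiniteDimensional F V] {s : J → V} (hs : LinearIndependent F s) :
    Nat.card {s' : {s' : J → V // LinearIndependent F s'} //
      (PenS s'.1 : Submodule F (⋀[F]^3 V)) = PenS s} =
    Nat.card (GL (Fin 2) F) * (Fintype.card F ^ 4 * Nat.card (GL (Fin 2) F)) := by
  have hM : Nat.card (Matrix (Fin 2) (Fin 2) F) = Fintype.card F ^ 4 := by
    rw [Matrix, Nat.card_eq_fintype_card, Fintype.card_fun, Fintype.card_fun, ← pow_mul]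
    simp
  rw [← hM, ← Nat.card_prod, ← Nat.card_prod]
  symm
  have hdet : ∀ p : GL (Fin 2) F × Matrix (Fin 2) (Fin 2) F × GL (Fin 2) F,
      (Matrix.fromBlocks (p.1 : Matrix (Fin 2) (Fin 2) F) 0 p.2.1
        (p.2.2 : Matrix (Fin 2) (Fin 2) F)).det ≠ 0 := by
    intro p
    rw [Matrix.det_fromBlocks_zero₁₂]
    exact mul_ne_zero ((Matrix.isUnit_iff_isUnit_det _).1 p.1.isUnit).ne_zero
      ((Matrix.isUnit_iff_isUnit_det _).1 p.2.2.isUnit).ne_zero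
  refine Nat.card_congr (Equiv.ofBijective
    (fun p => ⟨⟨act (Matrix.fromBlocks (p.1 : Matrix (Fin 2) (Fin 2) F) 0 p.2.1
        (p.2.2 : Matrix (Fin 2) (Fin 2) F)) s, (li_act_iff _ hs).2 (hdet p)⟩,
        PenS_act _ _ _ hs ((li_act_iff _ hs).2 (hdet p))⟩) ⟨?_, ?_⟩)
  · rintro ⟨X, Y, Z⟩ ⟨X', Y', Z'⟩ h
    simp only [Subtype.mk.injEq] at h
    have := act_inj hs h
    rw [Matrix.fromBlocks_inj] at this
    obtain ⟨h1, -, h2, h3⟩ := this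
    rw [Units.ext h1, h2, Units.ext h3]
  · rintro ⟨⟨s', hs'⟩, h⟩
    obtain ⟨X, Y, Z, rfl⟩ := exists_act hs hs' h
    have hd := (li_act_iff _ hs).1 hs'
    rw [Matrix.det_fromBlocks_zero₁₂] at hd
    refine ⟨⟨Matrix.GeneralLinearGroup.mkOfDetNeZero X (left_ne_zero_of_mul hd), Y,
      Matrix.GeneralLinearGroup.mkOfDetNeZero Z (right_ne_zero_of_mul hd)⟩, ?_⟩
    rfl

theorem card_X [Fintype F] [Finite V] (h6 : finrank F V = 6) :
    Nat.card {s : J → V // LinearIndependent F s} =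
      ∏ i : Fin 4, (Fintype.card F ^ 6 - Fintype.card F ^ i.val) := by
  rw [← h6, ← card_linearIndependent (by omega)]
  refine Nat.card_congr (Equiv.subtypeEquiv (Equiv.arrowCongr finSumFinEquiv (Equiv.refl V)) ?_)
  intro s
  exact (linearIndependent_equiv finSumFinEquiv.symm).symm

theorem arith {q N : ℕ} (hq : 2 ≤ q)
    (h : ∏ i : Fin 4, (q ^ 6 - q ^ i.val) =
      N * ((∏ i : Fin 2, (q ^ 2 - q ^ i.val)) * (q ^ 4 * ∏ i : Fin 2, (q ^ 2 - q ^ i.val)))) :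
    N = (q ^ 2 + q + 1) ^ 2 * (q ^ 2 - q + 1) * (q ^ 2 + 1) *
      (q ^ 4 + q ^ 3 + q ^ 2 + q + 1) := by
  have hle : ∀ {a b : ℕ}, a ≤ b → q ^ a ≤ q ^ b := fun h => Nat.pow_le_pow_right (by omega) h
  have hz : (0 : ℤ) < q - 1 := by have : (2 : ℤ) ≤ q := by exact_mod_cast hq
                                  linarith
  have hq0 : (0 : ℤ) < q := by linarith
  have hf : ((q : ℤ) ^ 2 - 1) * (q ^ 2 - q) * (q ^ 4 * ((q ^ 2 - 1) * (q ^ 2 - q))) ≠ 0 := by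
    have e1 : (q : ℤ) ^ 2 - 1 = (q - 1) * (q + 1) := by ring
    have e2 : (q : ℤ) ^ 2 - q = (q - 1) * q := by ring
    rw [e1, e2]
    positivity
  simp only [Fin.prod_univ_four, Fin.prod_univ_two, Fin.val_zero, Fin.val_one, Fin.val_two,
    show ((3 : Fin 4) : ℕ) = 3 from rfl, pow_zero, pow_one] at h
  zify [hle (show 0 ≤ 6 by omega), hle (show 1 ≤ 6 by omega), hle (show 2 ≤ 6 by omega)] at h ⊢
  have c1 : q ≤ q ^ 2 := by nlinarith
  have c2 : 1 ≤ q ^ 2 := by nlinarith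
  have c3 : 1 ≤ q ^ 6 := Nat.one_le_pow _ _ (by omega)
  have c4 : q ≤ q ^ 6 := by simpa using hle (show 1 ≤ 6 by omega)
  have c5 : q ^ 2 ≤ q ^ 6 := hle (by omega)
  have c6 : q ^ 3 ≤ q ^ 6 := hle (by omega)
  push_cast [Nat.cast_sub c1, Nat.cast_sub c2, Nat.cast_sub c3, Nat.cast_sub c4, Nat.cast_sub c5,
    Nat.cast_sub c6] at h ⊢
  apply mul_right_cancel₀ hf
  rw [← h]
  ring

theorem main [Fintype F] [Finite V] (h6 : finrank F V = 6) :
    ∏ i : Fin 4, (Fintype.card F ^ 6 - Fintype.card F ^ i.val) =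
    Nat.card {P : Submodule F (⋀[F]^3 V) // finrank F P = 2 ∧ ∀ ω ∈ P, ∃ a b c : V,
      (ω : ExteriorAlgebra F V) = ExteriorAlgebra.ιMulti F 3 ![a, b, c]} *
      ((∏ i : Fin 2, (Fintype.card F ^ 2 - Fintype.card F ^ i.val)) *
        (Fintype.card F ^ 4 * ∏ i : Fin 2, (Fintype.card F ^ 2 - Fintype.card F ^ i.val))) := by
  rw [← Matrix.card_GL_field, ← card_X h6]
  have : FiniteDimensional F V := inferInstance
  have hfin : Finite (⋀[F]^3 V) := Module.finite_of_finite F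
  let f : {s : J → V // LinearIndependent F s} → {P : Submodule F (⋀[F]^3 V) //
      finrank F P = 2 ∧ ∀ ω ∈ P, ∃ a b c : V,
      (ω : ExteriorAlgebra F V) = ExteriorAlgebra.ιMulti F 3 ![a, b, c]} := fun s =>
    ⟨PenS s.1, PenS_finrank s.2, fun ω hω => by
      obtain ⟨x, y, rfl⟩ := mem_Pen.1 hω
      exact ⟨_, _, _, T_coe _ _ _⟩⟩
  have hf : Function.Surjective f := by
    rintro ⟨P, h2, hP⟩
    obtain ⟨a, b, c, d, hli, hPen⟩ := exists_pencil P h2 (fun ω hω => by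
      obtain ⟨a, b, c, h⟩ := hP ω hω
      exact ⟨a, b, c, Subtype.ext h⟩)
    exact ⟨⟨Sum.elim ![a, b] ![c, d], li_J.2 hli⟩, Subtype.ext hPen⟩
  have hfinP : Finite (Submodule F (⋀[F]^3 V)) := inferInstance
  rw [← Nat.card_congr (Equiv.sigmaFiberEquiv f)]
  letI := Fintype.ofFinite {P : Submodule F (⋀[F]^3 V) //
      finrank F P = 2 ∧ ∀ ω ∈ P, ∃ a b c : V,
      (ω : ExteriorAlgebra F V) = ExteriorAlgebra.ιMulti F 3 ![a, b, c]}
  rw [Nat.card_sigma, Nat.card_eq_fintype_card (α := {P : Submodule F (⋀[F]^3 V) // _}),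
    ← smul_eq_mul, ← Finset.card_univ]
  apply Finset.sum_eq_card_nsmul
  intro P _
  obtain ⟨s, rfl⟩ := hf P
  rw [← card_fiber s.2]
  exact Nat.card_congr (Equiv.subtypeEquivRight fun s' => Subtype.ext_iff)

end Stmt6

/-- The number of 2-dimensional subspaces of `⋀³(F⁶)`, over a finite field with `q`
elements, all of whose elements are decomposable, equals
`(q²+q+1)²(q²−q+1)(q²+1)(q⁴+q³+q²+q+1)`. -/
theorem stmt_6 (F : Type*) [Field F] [Fintype F] (q : ℕ) (hq : Fintype.card F = q) :
    Nat.card {P : Submodule F (⋀[F]^3 (Fin 6 → F)) //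
      Module.finrank F P = 2 ∧
      ∀ ω ∈ P, ∃ v₁ v₂ v₃ : Fin 6 → F,
        (ω : ExteriorAlgebra F (Fin 6 → F)) = ExteriorAlgebra.ιMulti F 3 ![v₁, v₂, v₃]} =
    (q ^ 2 + q + 1) ^ 2 * (q ^ 2 - q + 1) * (q ^ 2 + 1) *
      (q ^ 4 + q ^ 3 + q ^ 2 + q + 1) := by
  subst hq
  exact Stmt6.arith Fintype.one_lt_card (Stmt6.main (by simp))
end

section
/- Let F be a finite field with q elements. The number of 2-dimensional F-linear subspaces of the space of 3×3 matrices over F in which every matrix has rank ≤ 1 equals 2(q²+q+1)². -/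
open Matrix

/-- The space of matrices `u vᵀ` with `v` orthogonal to `n`. -/
noncomputable def kerDot {F : Type*} [Field F] (n : Fin 3 → F) : Submodule F (Fin 3 → F) :=
  LinearMap.ker (dotProductBilin F F n)

noncomputable def lineW {F : Type*} [Field F] (u n : Fin 3 → F) :
    Submodule F (Matrix (Fin 3) (Fin 3) F) :=
  (kerDot n).map (vecMulVecBilin F F u)

noncomputable def trE (F : Type*) [Field F] :
    Matrix (Fin 3) (Fin 3) F ≃ₗ[F] Matrix (Fin 3) (Fin 3) F :=
  transposeLinearEquiv (Fin 3) (Fin 3) F F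

theorem mem_kerDot {F : Type*} [Field F] (n v : Fin 3 → F) : v ∈ kerDot n ↔ n ⬝ᵥ v = 0 := by
  simp [kerDot]

theorem mem_lineW {F : Type*} [Field F] (u n : Fin 3 → F) (A : Matrix (Fin 3) (Fin 3) F) :
    A ∈ lineW u n ↔ ∃ v, n ⬝ᵥ v = 0 ∧ vecMulVec u v = A := by
  simp [lineW, mem_kerDot]

theorem mem_tr_lineW {F : Type*} [Field F] (u n : Fin 3 → F) (A : Matrix (Fin 3) (Fin 3) F) :
    A ∈ (lineW u n).map (trE F).toLinearMap ↔ ∃ v, n ⬝ᵥ v = 0 ∧ vecMulVec v u = A := by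
  simp only [Submodule.mem_map, mem_lineW]
  constructor
  · rintro ⟨B, ⟨v, hv, rfl⟩, rfl⟩
    exact ⟨v, hv, by simp [trE, transpose_vecMulVec]⟩
  · rintro ⟨v, hv, rfl⟩
    exact ⟨_, ⟨v, hv, rfl⟩, by simp [trE, transpose_vecMulVec]⟩

theorem finrank_kerDot {F : Type*} [Field F] (n : Fin 3 → F) (hn : n ≠ 0) :
    Module.finrank F (kerDot n) = 2 := by
  have h : (dotProductBilin F F n : Module.Dual F (Fin 3 → F)) ≠ 0 := by
    intro h
    apply hn
    ext i
    have := LinearMap.congr_fun h (Pi.single i 1)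
    simpa using this
  have := Module.Dual.finrank_ker_add_one_of_ne_zero h
  simp only [Module.finrank_fin_fun] at this
  unfold kerDot
  omega

theorem vmv_cancel {F : Type*} [Field F] {u u' v v' : Fin 3 → F} (hu : u ≠ 0)
    (h : vecMulVec u v = vecMulVec u' v') : ∃ t : F, v = t • v' := by
  obtain ⟨i, hi⟩ := Function.ne_iff.1 hu
  refine ⟨(u i)⁻¹ * u' i, ?_⟩
  ext j
  have := congrFun (congrFun h i) j
  simp only [vecMulVec_apply] at this
  simp only [Pi.zero_apply] at hi
  simp only [Pi.smul_apply, smul_eq_mul]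
  field_simp
  linear_combination this

theorem vmv_cancel' {F : Type*} [Field F] {u u' v v' : Fin 3 → F} (hv : v ≠ 0)
    (h : vecMulVec u v = vecMulVec u' v') : ∃ t : F, u = t • u' := by
  apply vmv_cancel (u := v) (u' := v') hv
  rw [← transpose_vecMulVec, h, transpose_vecMulVec]

theorem vmv_inj {F : Type*} [Field F] {u : Fin 3 → F} (hu : u ≠ 0) :
    Function.Injective (vecMulVecBilin F F u : (Fin 3 → F) →ₗ[F] Matrix (Fin 3) (Fin 3) F) := by
  intro v v' h
  obtain ⟨i, hi⟩ := Function.ne_iff.1 hu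
  ext j
  have := congrFun (congrFun h i) j
  exact mul_left_cancel₀ hi this

theorem finrank_lineW {F : Type*} [Field F] (u n : Fin 3 → F) (hu : u ≠ 0) (hn : n ≠ 0) :
    Module.finrank F (lineW u n) = 2 := by
  rw [← finrank_kerDot n hn]
  exact (Submodule.equivMapOfInjective _ (vmv_inj hu) (kerDot n)).finrank_eq.symm

theorem rank_lineW {F : Type*} [Field F] (u n : Fin 3 → F) :
    ∀ A ∈ lineW u n, A.rank ≤ 1 := by
  intro A hA
  obtain ⟨v, -, rfl⟩ := (mem_lineW _ _ _).1 hA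
  exact rank_vecMulVec_le _ _

theorem rank_tr_lineW {F : Type*} [Field F] (u n : Fin 3 → F) :
    ∀ A ∈ (lineW u n).map (trE F).toLinearMap, A.rank ≤ 1 := by
  intro A hA
  obtain ⟨v, -, rfl⟩ := (mem_tr_lineW _ _ _).1 hA
  exact rank_vecMulVec_le _ _

theorem exists_ker_ne {F : Type*} [Field F] (n : Fin 3 → F) (hn : n ≠ 0) (w : Fin 3 → F) :
    ∃ v, n ⬝ᵥ v = 0 ∧ ∀ t : F, v ≠ t • w := by
  by_contra! h
  have h1 : kerDot n ≤ Submodule.span F {w} := by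
    intro v hv
    obtain ⟨t, rfl⟩ := h v ((mem_kerDot _ _).1 hv)
    exact Submodule.smul_mem _ _ (Submodule.mem_span_singleton_self w)
  have h2 := Submodule.finrank_mono h1
  have h3 := finrank_span_le_card (R := F) ({w} : Set (Fin 3 → F))
  rw [finrank_kerDot n hn] at h2
  simp at h3
  omega

theorem prop_of_cross {F : Type*} [Field F] {a c : Fin 3 → F} (ha : a ≠ 0)
    (h : crossProduct a c = 0) : ∃ t : F, t • a = c := by
  by_contra! h'
  exact crossProduct_ne_zero_iff_linearIndependent.2 ((LinearIndependent.pair_iff' ha).2 h') h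

theorem lineW_inj {F : Type*} [Field F] {u n u' n' : Fin 3 → F} (hu : u ≠ 0) (hn : n ≠ 0)
    (h : lineW u n = lineW u' n') :
    (∃ t : F, t • u' = u) ∧ (∃ t : F, t • n = n') := by
  constructor
  · obtain ⟨v, hv, hv0⟩ := exists_ker_ne n hn 0
    have : vecMulVec u v ∈ lineW u' n' := h ▸ (mem_lineW _ _ _).2 ⟨v, hv, rfl⟩
    obtain ⟨v', -, h'⟩ := (mem_lineW _ _ _).1 this
    obtain ⟨t, ht⟩ := vmv_cancel' (by simpa using hv0 0) h'.symm
    exact ⟨t, ht.symm⟩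
  · apply prop_of_cross hn
    have key : ∀ v, n ⬝ᵥ v = 0 → n' ⬝ᵥ v = 0 := by
      intro v hv
      have : vecMulVec u v ∈ lineW u' n' := h ▸ (mem_lineW _ _ _).2 ⟨v, hv, rfl⟩
      obtain ⟨v', hv', h'⟩ := (mem_lineW _ _ _).1 this
      obtain ⟨t, rfl⟩ := vmv_cancel hu h'.symm
      simp [hv']
    have h2 : ∀ w, w ⬝ᵥ crossProduct n n' = 0 := by
      intro w
      have := key (crossProduct w n) (dot_cross_self _ _)
      rwa [triple_product_permutation] at this
    exact dotProduct_eq_zero_iff.1 (fun w => by rw [dotProduct_comm]; exact h2 w)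

theorem lineW_ne_tr {F : Type*} [Field F] {u n u' n' : Fin 3 → F} (hu : u ≠ 0) (hn : n ≠ 0) :
    lineW u n ≠ (lineW u' n').map (trE F).toLinearMap := by
  intro h
  obtain ⟨v, hv, hv0⟩ := exists_ker_ne n hn u'
  have : vecMulVec u v ∈ (lineW u' n').map (trE F).toLinearMap :=
    h ▸ (mem_lineW _ _ _).2 ⟨v, hv, rfl⟩
  obtain ⟨v', -, h'⟩ := (mem_tr_lineW _ _ _).1 this
  obtain ⟨t, ht⟩ := vmv_cancel hu h'.symm
  exact hv0 t ht

theorem lineW_smul {F : Type*} [Field F] {u n : Fin 3 → F} {s t : F} (hs : s ≠ 0) (ht : t ≠ 0) :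
    lineW (s • u) (t • n) = lineW u n := by
  ext A
  simp only [mem_lineW]
  constructor
  · rintro ⟨v, hv, rfl⟩
    refine ⟨s • v, ?_, ?_⟩
    · simp [ht] at hv
      simp [hv]
    · rw [vecMulVec_smul, smul_vecMulVec]
  · rintro ⟨v, hv, rfl⟩
    refine ⟨s⁻¹ • v, by simp [hv], ?_⟩
    rw [vecMulVec_smul, smul_vecMulVec, smul_smul, inv_mul_cancel₀ hs, one_smul]

theorem exists_lineW {F : Type*} [Field F] (W : Submodule F (Matrix (Fin 3) (Fin 3) F))
    (hW : Module.finrank F W = 2) (a : Fin 3 → F) (ha : a ≠ 0)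
    (h : ∀ A ∈ W, ∃ v, A = vecMulVec a v) : ∃ n, n ≠ 0 ∧ W = lineW a n := by
  set L : (Fin 3 → F) →ₗ[F] Matrix (Fin 3) (Fin 3) F := vecMulVecBilin F F a with hL
  have hmap : (W.comap L).map L = W := by
    apply Submodule.map_comap_eq_of_le
    intro A hA
    obtain ⟨v, rfl⟩ := h A hA
    exact ⟨v, rfl⟩
  have hV : Module.finrank F (W.comap L) = 2 := by
    rw [← hW]
    conv_rhs => rw [← hmap]
    exact (Submodule.equivMapOfInjective L (vmv_inj ha) (W.comap L)).finrank_eq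
  let b := Module.finBasisOfFinrankEq F (W.comap L) hV
  have hli : LinearIndependent F ![(b 0 : Fin 3 → F), (b 1 : Fin 3 → F)] := by
    have := b.linearIndependent.map' (W.comap L).subtype (Submodule.ker_subtype _)
    have e : ![(b 0 : Fin 3 → F), (b 1 : Fin 3 → F)] = (W.comap L).subtype ∘ b := by
      ext i j
      fin_cases i <;> rfl
    rw [e]
    exact this
  have hn := crossProduct_ne_zero_iff_linearIndependent.2 hli
  refine ⟨_, hn, ?_⟩
  refine hmap.symm.trans ?_
  unfold lineW
  congr 1
  apply Submodule.eq_of_le_of_finrank_eq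
  · intro v hv
    have := b.sum_repr ⟨v, hv⟩
    rw [Fin.sum_univ_two] at this
    have h2 := congrArg Subtype.val this
    simp only [Submodule.coe_add, Submodule.coe_smul] at h2
    rw [mem_kerDot, ← h2, dotProduct_comm]
    simp only [add_dotProduct, smul_dotProduct, dot_self_cross, dot_cross_self, smul_zero, add_zero]
  · rw [hV, finrank_kerDot _ hn]

theorem exists_vmv {F : Type*} [Field F] (A : Matrix (Fin 3) (Fin 3) F) (h : A.rank ≤ 1) :
    ∃ a b, A = vecMulVec a b := by
  unfold Matrix.rank at h
  obtain ⟨a, ha⟩ := finrank_le_one_iff.1 h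
  choose f hf using ha
  refine ⟨a, fun j => f ⟨A *ᵥ Pi.single j 1, ⟨_, rfl⟩⟩, ?_⟩
  ext i j
  have := congrFun (congrArg Subtype.val (hf ⟨A *ᵥ Pi.single j 1, ⟨_, rfl⟩⟩)) i
  simp only [Submodule.coe_smul, Pi.smul_apply, smul_eq_mul] at this
  rw [vecMulVec_apply, mul_comm, this]
  simp

theorem dichotomy {F : Type*} [Field F] {a b c d e f : Fin 3 → F}
    (h : vecMulVec a b + vecMulVec c d = vecMulVec e f) :
    crossProduct a c = 0 ∨ crossProduct b d = 0 := by
  have key : ∀ i k j l, (a i * c k - a k * c i) * (b j * d l - b l * d j) = 0 := by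
    intro i k j l
    have e1 := congrFun (congrFun h i) j
    have e2 := congrFun (congrFun h k) l
    have e3 := congrFun (congrFun h i) l
    have e4 := congrFun (congrFun h k) j
    simp only [Matrix.add_apply, vecMulVec_apply] at e1 e2 e3 e4
    have : (a i * b j + c i * d j) * (a k * b l + c k * d l) =
      (a i * b l + c i * d l) * (a k * b j + c k * d j) := by
      rw [e1, e2, e3, e4]; ring
    linear_combination this
  by_cases hac : ∀ i k, a i * c k - a k * c i = 0
  · left
    rw [cross_apply]
    ext i
    fin_cases i
    · simpa using hac 1 2
    · simpa using (by linear_combination hac 2 0 : a 2 * c 0 - a 0 * c 2 = 0)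
    · simpa using hac 0 1
  · right
    push Not at hac
    obtain ⟨i, k, hik⟩ := hac
    have hbd : ∀ j l, b j * d l - b l * d j = 0 := fun j l =>
      (mul_eq_zero.1 (key i k j l)).resolve_left hik
    rw [cross_apply]
    ext i
    fin_cases i
    · simpa using hbd 1 2
    · simpa using hbd 2 0
    · simpa using hbd 0 1

theorem two_cases {F : Type*} [Field F] (W : Submodule F (Matrix (Fin 3) (Fin 3) F))
    (hW : Module.finrank F W = 2) (hr : ∀ A ∈ W, A.rank ≤ 1) :
    (∃ a, a ≠ 0 ∧ ∀ A ∈ W, ∃ v, A = vecMulVec a v) ∨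
    (∃ a, a ≠ 0 ∧ ∀ A ∈ W, ∃ v, A = vecMulVec v a) := by
  let B := Module.finBasisOfFinrankEq F W hW
  obtain ⟨a, b, hab⟩ := exists_vmv _ (hr _ (B 0).2)
  obtain ⟨c, d, hcd⟩ := exists_vmv _ (hr _ (B 1).2)
  obtain ⟨e, f, hef⟩ := exists_vmv _ (hr _ (W.add_mem (B 0).2 (B 1).2))
  rw [hab, hcd] at hef
  have h0 : vecMulVec a b ≠ 0 := by
    rw [← hab]
    simpa using B.ne_zero 0
  have ha : a ≠ 0 := by rintro rfl; simp at h0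
  have hb : b ≠ 0 := by rintro rfl; simp at h0
  have hall : ∀ A ∈ W, ∃ x y : F, A = x • vecMulVec a b + y • vecMulVec c d := by
    intro A hA
    have := B.sum_repr ⟨A, hA⟩
    rw [Fin.sum_univ_two] at this
    have h2 := congrArg Subtype.val this
    simp only [Submodule.coe_add, Submodule.coe_smul] at h2
    rw [hab, hcd] at h2
    exact ⟨_, _, h2.symm⟩
  rcases dichotomy hef with h | h
  · left
    obtain ⟨t, rfl⟩ := prop_of_cross ha h
    refine ⟨a, ha, fun A hA => ?_⟩
    obtain ⟨x, y, rfl⟩ := hall A hA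
    refine ⟨x • b + (y * t) • d, ?_⟩
    simp only [smul_vecMulVec, vecMulVec_add, vecMulVec_smul, smul_smul]
  · right
    obtain ⟨t, rfl⟩ := prop_of_cross hb h
    refine ⟨b, hb, fun A hA => ?_⟩
    obtain ⟨x, y, rfl⟩ := hall A hA
    refine ⟨x • a + (y * t) • c, ?_⟩
    simp only [smul_vecMulVec, add_vecMulVec, vecMulVec_smul, smul_smul]

theorem exists_rep {F : Type*} [Field F] (u : Fin 3 → F) (hu : u ≠ 0) :
    ∃ p : Projectivization F (Fin 3 → F), ∃ s : F, s ≠ 0 ∧ p.rep = s • u := by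
  obtain ⟨s, hs⟩ := Projectivization.exists_smul_eq_mk_rep F u hu
  exact ⟨Projectivization.mk F u hu, s, s.ne_zero, hs.symm⟩

theorem exists_rep_lineW {F : Type*} [Field F] (u n : Fin 3 → F) (hu : u ≠ 0) (hn : n ≠ 0) :
    ∃ p r : Projectivization F (Fin 3 → F), lineW p.rep r.rep = lineW u n := by
  obtain ⟨p, s, hs, hp⟩ := exists_rep u hu
  obtain ⟨r, t, ht, hr⟩ := exists_rep n hn
  exact ⟨p, r, by rw [hp, hr, lineW_smul hs ht]⟩

theorem rep_eq {F : Type*} [Field F] {p r : Projectivization F (Fin 3 → F)}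
    (h : ∃ t : F, t • r.rep = p.rep) : p = r := by
  rw [← p.mk_rep, ← r.mk_rep]
  exact (Projectivization.mk_eq_mk_iff' F _ _ p.rep_nonzero r.rep_nonzero).2 h

theorem lineW_rep_inj {F : Type*} [Field F] {p r p' r' : Projectivization F (Fin 3 → F)}
    (h : lineW p.rep r.rep = lineW p'.rep r'.rep) : p = p' ∧ r = r' := by
  obtain ⟨h1, h2⟩ := lineW_inj p.rep_nonzero r.rep_nonzero h
  exact ⟨rep_eq h1, (rep_eq h2).symm⟩

noncomputable def theMap (F : Type*) [Field F] :
    ((Projectivization F (Fin 3 → F) × Projectivization F (Fin 3 → F)) ⊕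
      (Projectivization F (Fin 3 → F) × Projectivization F (Fin 3 → F))) →
    {W : Submodule F (Matrix (Fin 3) (Fin 3) F) //
      Module.finrank F W = 2 ∧ ∀ A ∈ W, A.rank ≤ 1} :=
  Sum.elim
    (fun x => ⟨lineW x.1.rep x.2.rep,
      finrank_lineW _ _ x.1.rep_nonzero x.2.rep_nonzero, rank_lineW _ _⟩)
    (fun x => ⟨(lineW x.1.rep x.2.rep).map (trE F).toLinearMap,
      (LinearEquiv.finrank_map_eq (trE F) _).trans
        (finrank_lineW _ _ x.1.rep_nonzero x.2.rep_nonzero), rank_tr_lineW _ _⟩)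

theorem theMap_bij (F : Type*) [Field F] : Function.Bijective (theMap F) := by
  constructor
  · rintro (⟨p, r⟩ | ⟨p, r⟩) (⟨p', r'⟩ | ⟨p', r'⟩) h <;> replace h := congrArg Subtype.val h <;>
      simp only [theMap, Sum.elim_inl, Sum.elim_inr] at h
    · obtain ⟨rfl, rfl⟩ := lineW_rep_inj h
      rfl
    · exact (lineW_ne_tr p.rep_nonzero r.rep_nonzero h).elim
    · exact (lineW_ne_tr p'.rep_nonzero r'.rep_nonzero h.symm).elim
    · obtain ⟨rfl, rfl⟩ := lineW_rep_inj
        (Submodule.map_injective_of_injective (trE F).injective h)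
      rfl
  · rintro ⟨W, hW, hr⟩
    rcases two_cases W hW hr with ⟨a, ha, h⟩ | ⟨a, ha, h⟩
    · obtain ⟨n, hn, rfl⟩ := exists_lineW W hW a ha h
      obtain ⟨p, r, hpr⟩ := exists_rep_lineW a n ha hn
      exact ⟨Sum.inl (p, r), Subtype.ext hpr⟩
    · obtain ⟨n, hn, hWn⟩ := exists_lineW (W.map (trE F).toLinearMap)
        ((LinearEquiv.finrank_map_eq (trE F) _).trans hW) a ha (by
          rintro _ ⟨A, hA, rfl⟩
          obtain ⟨v, rfl⟩ := h A hA
          exact ⟨v, by simp [trE, transpose_vecMulVec]⟩)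
      obtain ⟨p, r, hpr⟩ := exists_rep_lineW a n ha hn
      refine ⟨Sum.inr (p, r), Subtype.ext ?_⟩
      simp only [theMap, Sum.elim_inr]
      rw [hpr, ← hWn, ← Submodule.map_comp]
      convert Submodule.map_id W
      ext A
      simp [trE]


/-- The number of 2-dimensional subspaces of the space of 3×3 matrices over a finite
field with `q` elements, in which every matrix has rank at most 1, equals
`2(q²+q+1)²`. -/
theorem stmt_7 (F : Type*) [Field F] [Fintype F] (q : ℕ) (hq : Fintype.card F = q) :
    Nat.card {W : Submodule F (Matrix (Fin 3) (Fin 3) F) //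
      Module.finrank F W = 2 ∧ ∀ A ∈ W, A.rank ≤ 1} =
    2 * (q ^ 2 + q + 1) ^ 2 := by
  rw [← Nat.card_eq_of_bijective _ (theMap_bij F), Nat.card_sum, Nat.card_prod,
    Projectivization.card_of_finrank F (Fin 3 → F) (n := 3) (by simp),
    Nat.card_eq_fintype_card, hq]
  simp only [Finset.sum_range_succ, Finset.sum_range_zero]
  ring
end

section
/- Let F be a finite field with q elements. The number of 2-dimensional F-linear subspaces of the space of alternating 6×6 matrices over F in which every matrix has rank ≤ 2 equals (q³+1)(q²+1)(q²+q+1)(q⁴+q³+q²+q+1). -/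
open Matrix

namespace PencilCount

variable {F : Type*} [Field F]

/-- The decomposable alternating matrix attached to two vectors. -/
def wedge (u v : Fin 6 → F) : Matrix (Fin 6) (Fin 6) F :=
  Matrix.of fun i j => u i * v j - v i * u j

lemma wedge_apply (u v : Fin 6 → F) (i j) : wedge u v i j = u i * v j - v i * u j := rfl

lemma wedge_rank (u v : Fin 6 → F) : (wedge u v).rank ≤ 2 := by
  have h : wedge u v = (Matrix.of fun i k => ![u i, -v i] k : Matrix (Fin 6) (Fin 2) F) *
      (Matrix.of ![v, u] : Matrix (Fin 2) (Fin 6) F) := by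
    ext i j; simp [wedge_apply, Matrix.mul_apply, Fin.sum_univ_two]; ring
  rw [h]
  refine (Matrix.rank_mul_le_left _ _).trans ?_
  simpa using Matrix.rank_le_card_width
    (Matrix.of fun i k => ![u i, -v i] k : Matrix (Fin 6) (Fin 2) F)

lemma wedge_lin (u v w : Fin 6 → F) (a b : F) :
    wedge u (a • v + b • w) = a • wedge u v + b • wedge u w := by
  ext i j; simp [wedge_apply]; ring

lemma wedge_smul_left (u v : Fin 6 → F) (a : F) :
    wedge (a • u) v = a • wedge u v := by
  ext i j; simp [wedge_apply]; ring

lemma wedge_alt (u v : Fin 6 → F) :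
    (wedge u v)ᵀ = -wedge u v ∧ ∀ i, wedge u v i i = 0 := by
  constructor
  · ext i j; simp [wedge_apply]; ring
  · intro i; simp [wedge_apply]; ring

lemma wedge_eq_zero {u x : Fin 6 → F} (hu : u ≠ 0) (h : wedge u x = 0) :
    ∃ c : F, x = c • u := by
  obtain ⟨i, hi⟩ := Function.ne_iff.1 hu
  simp only [Pi.zero_apply] at hi
  refine ⟨x i / u i, ?_⟩
  ext j
  have := congrFun (congrFun h i) j
  simp [wedge_apply] at this
  simp
  field_simp
  linear_combination this

lemma wedge_mem {u v u' v' : Fin 6 → F} (h : wedge u v = wedge u' v') (h0 : wedge u v ≠ 0) :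
    ∃ s t : F, u = s • u' + t • v' := by
  have : ∃ i j, wedge u v i j ≠ 0 := by
    by_contra! hc
    exact h0 (by ext i j; simpa using hc i j)
  obtain ⟨i, j, hij⟩ := this
  have key : ∀ k, wedge u v i j * u k = u j * wedge u' v' i k - u i * wedge u' v' j k := by
    intro k; rw [← h]; simp [wedge_apply]; ring
  simp only [wedge_apply u' v'] at key
  refine ⟨(-(u j * v' i) + u i * v' j) / wedge u v i j,
    (u j * u' i - u i * u' j) / wedge u v i j, ?_⟩
  ext k
  simp only [Pi.add_apply, Pi.smul_apply, smul_eq_mul]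
  field_simp
  linear_combination key k

/-- Linear independence of a triple, spelled out. -/
lemma li_iff (s : Fin 3 → Fin 6 → F) : LinearIndependent F s ↔
    ∀ x y z : F, x • s 0 + y • s 1 + z • s 2 = 0 → x = 0 ∧ y = 0 ∧ z = 0 := by
  rw [Fintype.linearIndependent_iff]
  constructor
  · intro h x y z hx
    have := h ![x, y, z] (by simpa [Fin.sum_univ_three] using hx)
    exact ⟨this 0, this 1, this 2⟩
  · intro h g hg
    rw [Fin.sum_univ_three] at hg
    obtain ⟨h0, h1, h2⟩ := h _ _ _ hg
    intro i; fin_cases i <;> assumption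

/-- The pencil attached to a triple. -/
def phi (s : Fin 3 → Fin 6 → F) : Submodule F (Matrix (Fin 6) (Fin 6) F) :=
  Submodule.span F (Set.range ![wedge (s 0) (s 1), wedge (s 0) (s 2)])

lemma mem_phi (s : Fin 3 → Fin 6 → F) (A) : A ∈ phi s ↔
    ∃ a b : F, a • wedge (s 0) (s 1) + b • wedge (s 0) (s 2) = A := by
  unfold phi
  rw [show Set.range ![wedge (s 0) (s 1), wedge (s 0) (s 2)] =
    {wedge (s 0) (s 1), wedge (s 0) (s 2)} by simp [Matrix.range_cons, Set.pair_comm]]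
  exact Submodule.mem_span_pair

lemma pair_li {s : Fin 3 → Fin 6 → F} (hs : LinearIndependent F s) :
    LinearIndependent F ![wedge (s 0) (s 1), wedge (s 0) (s 2)] := by
  rw [LinearIndependent.pair_iff]
  intro a b h
  rw [← wedge_lin] at h
  obtain ⟨c, hc⟩ := wedge_eq_zero (hs.ne_zero 0) h
  have := (li_iff s).1 hs (-c) a b (by rw [add_assoc, hc]; simp)
  exact this.2

lemma finrank_phi {s : Fin 3 → Fin 6 → F} (hs : LinearIndependent F s) :
    Module.finrank F (phi s) = 2 := by
  exact (finrank_span_eq_card (pair_li hs)).trans (by simp)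

/-- The property of the pencils counted. -/
def Good (W : Submodule F (Matrix (Fin 6) (Fin 6) F)) : Prop :=
  Module.finrank F W = 2 ∧ ∀ A ∈ W, (Aᵀ = -A ∧ ∀ i, A i i = 0) ∧ A.rank ≤ 2

lemma good_phi {s : Fin 3 → Fin 6 → F} (hs : LinearIndependent F s) : Good (phi s) := by
  refine ⟨finrank_phi hs, fun A hA => ?_⟩
  obtain ⟨a, b, rfl⟩ := (mem_phi s A).1 hA
  rw [← wedge_lin]
  exact ⟨wedge_alt _ _, wedge_rank _ _⟩

/-- Parameters for the fibres of `phi`. -/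
abbrev Par (F : Type*) [Field F] := Fˣ × F × F × GL (Fin 2) F

/-- The action of parameters on triples. -/
def act (p : Par F) (s : Fin 3 → Fin 6 → F) : Fin 3 → Fin 6 → F :=
  ![(p.1 : F) • s 0, p.2.1 • s 0 + p.2.2.2.1 0 0 • s 1 + p.2.2.2.1 0 1 • s 2,
    p.2.2.1 • s 0 + p.2.2.2.1 1 0 • s 1 + p.2.2.2.1 1 1 • s 2]

lemma det_ne (M : GL (Fin 2) F) : M.1 0 0 * M.1 1 1 - M.1 0 1 * M.1 1 0 ≠ 0 := by
  rw [← Matrix.det_fin_two]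
  exact ((Matrix.isUnit_iff_isUnit_det _).1 M.isUnit).ne_zero

lemma act_li (p : Par F) {s : Fin 3 → Fin 6 → F} (hs : LinearIndependent F s) :
    LinearIndependent F (act p s) := by
  obtain ⟨a, b, e, M⟩ := p
  rw [li_iff]
  intro x y z h
  simp only [act, Matrix.cons_val] at h
  obtain ⟨h0, h1, h2⟩ := (li_iff s).1 hs (x * a + y * b + z * e)
    (y * M.1 0 0 + z * M.1 1 0) (y * M.1 0 1 + z * M.1 1 1) (by rw [← h]; module)
  have hd := det_ne M
  have hy : y = 0 := by
    have : (M.1 0 0 * M.1 1 1 - M.1 0 1 * M.1 1 0) * y = 0 := by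
      linear_combination M.1 1 1 * h1 - M.1 1 0 * h2
    simpa [hd] using this
  have hz : z = 0 := by
    have : (M.1 0 0 * M.1 1 1 - M.1 0 1 * M.1 1 0) * z = 0 := by
      linear_combination M.1 0 0 * h2 - M.1 0 1 * h1
    simpa [hd] using this
  subst hy hz
  simpa using h0

lemma wedge_self_add (u v w : Fin 6 → F) (a b c d : F) :
    wedge (a • u) (b • u + c • v + d • w) = (a * c) • wedge u v + (a * d) • wedge u w := by
  ext i j; simp [wedge_apply]; ring

lemma phi_act (p : Par F) {s : Fin 3 → Fin 6 → F} (hs : LinearIndependent F s) :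
    phi (act p s) = phi s := by
  apply Submodule.eq_of_le_of_finrank_eq
  · refine Submodule.span_le.2 ?_
    rintro _ ⟨i, rfl⟩
    fin_cases i
    · exact (mem_phi _ _).2 ⟨_, _, (wedge_self_add _ _ _ _ _ _ _).symm⟩
    · exact (mem_phi _ _).2 ⟨_, _, (wedge_self_add _ _ _ _ _ _ _).symm⟩
  · rw [finrank_phi hs, finrank_phi (act_li p hs)]

lemma act_inj {p p' : Par F} {s : Fin 3 → Fin 6 → F} (hs : LinearIndependent F s)
    (h : act p s = act p' s) : p = p' := by
  obtain ⟨a, b, e, M⟩ := p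
  obtain ⟨a', b', e', M'⟩ := p'
  have h0 := congrFun h 0
  have h1 := congrFun h 1
  have h2 := congrFun h 2
  simp only [act, Matrix.cons_val] at h0 h1 h2
  obtain ⟨k0, -, -⟩ := (li_iff s).1 hs (a - a') 0 0
    (by rw [← sub_eq_zero] at h0; rw [← h0]; module)
  obtain ⟨k1, k2, k3⟩ := (li_iff s).1 hs (b - b') (M.1 0 0 - M'.1 0 0) (M.1 0 1 - M'.1 0 1)
    (by rw [← sub_eq_zero] at h1; rw [← h1]; module)
  obtain ⟨k4, k5, k6⟩ := (li_iff s).1 hs (e - e') (M.1 1 0 - M'.1 1 0) (M.1 1 1 - M'.1 1 1)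
    (by rw [← sub_eq_zero] at h2; rw [← h2]; module)
  rw [sub_eq_zero] at *
  have hM : M = M' := by
    apply Units.ext
    ext i j
    fin_cases i <;> fin_cases j <;> assumption
  rw [Units.ext k0, k1, k4, hM]

lemma fibre {s t : Fin 3 → Fin 6 → F} (hs : LinearIndependent F s)
    (ht : LinearIndependent F t) (h : phi s = phi t) : ∃ p, act p s = t := by
  have m1 : wedge (t 0) (t 1) ∈ phi s := by
    rw [h]; exact (mem_phi _ _).2 ⟨1, 0, by simp⟩
  have m2 : wedge (t 0) (t 2) ∈ phi s := by
    rw [h]; exact (mem_phi _ _).2 ⟨0, 1, by simp⟩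
  obtain ⟨c, d, e1⟩ := (mem_phi _ _).1 m1
  obtain ⟨f, g, e2⟩ := (mem_phi _ _).1 m2
  rw [← wedge_lin] at e1 e2
  have hp := pair_li ht
  have n1 : wedge (t 0) (t 1) ≠ 0 := hp.ne_zero 0
  have n2 : wedge (t 0) (t 2) ≠ 0 := hp.ne_zero 1
  obtain ⟨a, r, ha⟩ := wedge_mem e1.symm n1
  obtain ⟨a', r', ha'⟩ := wedge_mem e2.symm n2
  have hr : r = 0 := by
    rw [LinearIndependent.pair_iff] at hp
    refine (hp r (-r') ?_).1
    have : wedge (s 0) (t 0) = wedge (s 0) (t 0) := rfl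
    nth_rewrite 1 [ha] at this
    rw [ha', wedge_lin (s 0) (s 0), wedge_lin (s 0) (s 0), e1, e2] at this
    have hz : wedge (s 0) (s 0) = 0 := by ext i j; simp [wedge_apply]
    rw [hz] at this
    simp only [smul_zero, zero_add] at this
    rw [this]; module
  rw [hr, zero_smul, add_zero] at ha
  have ha0 : a ≠ 0 := by
    rintro rfl
    exact ht.ne_zero 0 (by rw [ha, zero_smul])
  have step : ∀ (v : Fin 6 → F) (c d : F), wedge (s 0) (c • s 1 + d • s 2) = wedge (t 0) v →
      ∃ b : F, v = b • s 0 + (a⁻¹ * c) • s 1 + (a⁻¹ * d) • s 2 := by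
    intro v c d hv
    obtain ⟨k, hk⟩ := wedge_eq_zero (u := s 0) (x := a • v + (-1 : F) • (c • s 1 + d • s 2))
      (hs.ne_zero 0) (by rw [wedge_lin, ← wedge_smul_left, ← ha, hv]; module)
    refine ⟨a⁻¹ * k, ?_⟩
    have : a • v = k • s 0 + c • s 1 + d • s 2 := by
      rw [← hk]; module
    calc v = a⁻¹ • (a • v) := by rw [smul_smul, inv_mul_cancel₀ ha0, one_smul]
      _ = _ := by rw [this]; module
  obtain ⟨b, hb⟩ := step _ _ _ e1
  obtain ⟨e, he⟩ := step _ _ _ e2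
  generalize a⁻¹ * c = c at hb
  generalize a⁻¹ * d = d at hb
  generalize a⁻¹ * f = f at he
  generalize a⁻¹ * g = g at he
  have hdet : c * g - d * f ≠ 0 := by
    intro h0
    have q1 := (li_iff t).1 ht (-(g * b - d * e) / a) g (-d) (by
      rw [ha, hb, he, smul_smul, div_mul_cancel₀ _ ha0]
      have : (c * g - d * f) • s 1 = 0 := by rw [h0, zero_smul]
      rw [← this]; module)
    have q2 := (li_iff t).1 ht ((f * b - c * e) / a) (-f) c (by
      rw [ha, hb, he, smul_smul, div_mul_cancel₀ _ ha0]
      have : (c * g - d * f) • s 2 = 0 := by rw [h0, zero_smul]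
      rw [← this]; module)
    have hd0 : d = 0 := by simpa using q1.2.2
    have hc0 : c = 0 := q2.2.2
    have q3 := (li_iff t).1 ht (-b / a) 1 0 (by
      rw [ha, hb, hd0, hc0, smul_smul, div_mul_cancel₀ _ ha0]; module)
    exact one_ne_zero q3.2.1
  refine ⟨(Units.mk0 a ha0, b, e, Matrix.GeneralLinearGroup.mkOfDetNeZero !![c, d; f, g]
    (by rwa [Matrix.det_fin_two_of])), ?_⟩
  funext i
  fin_cases i
  · simp [act, ha]
  · simp [act, hb, Matrix.GeneralLinearGroup.mkOfDetNeZero]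
  · simp [act, he, Matrix.GeneralLinearGroup.mkOfDetNeZero]

lemma exists_wedge {A : Matrix (Fin 6) (Fin 6) F} (hA : Aᵀ = -A) (hd : ∀ i, A i i = 0)
    (hr : A.rank ≤ 2) : ∃ u v, A = wedge u v := by
  by_cases h0 : A = 0
  · exact ⟨0, 0, by rw [h0]; ext i j; simp [wedge_apply]⟩
  have : ∃ i j, A i j ≠ 0 := by
    by_contra! hc
    exact h0 (by ext i j; simpa using hc i j)
  obtain ⟨i, j, hij⟩ := this
  have hs : ∀ k l, A k l = - A l k := fun k l => by
    have := congrFun (congrFun hA l) k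
    simpa using this
  have minor : ∀ k l, (A.submatrix ![i, j, k] ![i, j, l]).det = 0 := by
    intro k l
    by_contra hne
    have h3 : (A.submatrix ![i, j, k] ![i, j, l]).rank = 3 := by
      have := Matrix.rank_of_isUnit (A.submatrix ![i, j, k] ![i, j, l])
        ((Matrix.isUnit_iff_isUnit_det _).2 (isUnit_iff_ne_zero.2 hne))
      simpa using this
    have h4 := Matrix.rank_submatrix_le A ![i, j, k] ![i, j, l]
    omega
  refine ⟨(A i j)⁻¹ • A i, A j, ?_⟩
  ext k l
  have := minor k l
  rw [Matrix.det_fin_three] at this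
  simp only [Matrix.submatrix_apply, Matrix.cons_val, hd, hs j i, hs k i, hs k j] at this
  have h2 : A i j * (A i j * A k l - A j l * A i k + A i l * A j k) = 0 := by
    linear_combination this
  have h3 := (mul_eq_zero.1 h2).resolve_left hij
  simp only [wedge_apply, Pi.smul_apply, smul_eq_mul]
  field_simp
  linear_combination h3

lemma wedge_change {a b u : Fin 6 → F} {x y : F} (hu : u = x • a + y • b) (h0 : u ≠ 0) :
    ∃ v, wedge a b = wedge u v := by
  by_cases hx : x = 0
  · have hy : y ≠ 0 := by
      rintro rfl; exact h0 (by rw [hu, hx]; simp)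
    refine ⟨(-y⁻¹) • a, ?_⟩
    ext i j
    simp only [hu, hx, wedge_apply, Pi.add_apply, Pi.smul_apply, smul_eq_mul]
    field_simp
    ring
  · refine ⟨x⁻¹ • b, ?_⟩
    ext i j
    simp only [hu, wedge_apply, Pi.add_apply, Pi.smul_apply, smul_eq_mul]
    field_simp
    ring

lemma rank_four {a b c d : Fin 6 → F} (h : LinearIndependent F ![a, b, c, d]) :
    2 < (wedge a b + wedge c d).rank := by
  let N : Matrix (Fin 4) (Fin 6) F := Matrix.of ![a, b, c, d]
  have hN : N.rank = 4 := by
    have := LinearIndependent.rank_matrix (M := N) h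
    simpa using this
  have hsurj : Function.Surjective N.mulVecLin := by
    rw [← LinearMap.range_eq_top]
    apply Submodule.eq_top_of_finrank_eq
    rw [← Matrix.rank, hN]; simp
  have hle : Submodule.span F (Set.range ![a, b, c, d]) ≤
      LinearMap.range (wedge a b + wedge c d).mulVecLin := by
    rw [Submodule.span_le]
    rintro _ ⟨i, rfl⟩
    obtain ⟨x, hx⟩ := hsurj (![![0, 1, 0, 0], ![-1, 0, 0, 0], ![0, 0, 0, 1], ![0, 0, -1, 0]] i)
    refine ⟨x, ?_⟩
    have e0 : a ⬝ᵥ x = _ := congrFun hx 0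
    have e1 : b ⬝ᵥ x = _ := congrFun hx 1
    have e2 : c ⬝ᵥ x = _ := congrFun hx 2
    have e3 : d ⬝ᵥ x = _ := congrFun hx 3
    have main : (wedge a b + wedge c d).mulVecLin x =
        (b ⬝ᵥ x) • a - (a ⬝ᵥ x) • b + (d ⬝ᵥ x) • c - (c ⬝ᵥ x) • d := by
      ext k
      simp [Matrix.mulVec, dotProduct, Fin.sum_univ_succ, wedge_apply]
      ring
    rw [main, e0, e1, e2, e3]
    fin_cases i <;> simp
  have h1 := Submodule.finrank_mono hle
  rw [finrank_span_eq_card h] at h1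
  have : (wedge a b + wedge c d).rank = Module.finrank F
    (LinearMap.range (wedge a b + wedge c d).mulVecLin) := rfl
  simp at h1
  omega

lemma phi_surj {W : Submodule F (Matrix (Fin 6) (Fin 6) F)} (hW : Good W) :
    ∃ s, LinearIndependent F s ∧ phi s = W := by
  obtain ⟨h2, hW⟩ := hW
  let B := Module.finBasisOfFinrankEq F W h2
  have hB : LinearIndependent F ![(B 0 : Matrix (Fin 6) (Fin 6) F), B 1] := by
    have := B.linearIndependent.map' W.subtype (Submodule.ker_subtype W)
    have he : ![(B 0 : Matrix (Fin 6) (Fin 6) F), B 1] = W.subtype ∘ B := by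
      funext i; fin_cases i <;> rfl
    rw [he]
    exact this
  have g0 := hW _ (B 0).2
  have g1 := hW _ (B 1).2
  have g2 := hW _ (B 0 + B 1).2
  obtain ⟨a, b, hab⟩ := exists_wedge g0.1.1 g0.1.2 g0.2
  obtain ⟨c, d, hcd⟩ := exists_wedge g1.1.1 g1.1.2 g1.2
  have hdep : ¬ LinearIndependent F ![a, b, c, d] := by
    intro h
    have := rank_four h
    rw [← hab, ← hcd] at this
    have h3 := g2.2
    rw [Submodule.coe_add] at h3
    omega
  have n0 : wedge a b ≠ 0 := by rw [← hab]; exact hB.ne_zero 0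
  have n1 : wedge c d ≠ 0 := by rw [← hcd]; exact hB.ne_zero 1
  have ind : ∀ (a b : Fin 6 → F) (x y : F), wedge a b ≠ 0 → x • a + y • b = 0 →
      x = 0 ∧ y = 0 := by
    intro a b x y hn h
    have k1 : x • wedge a b = wedge (x • a + y • b) b := by
      ext i j; simp [wedge_apply]; ring
    have k2 : y • wedge a b = wedge a (x • a + y • b) := by
      ext i j; simp [wedge_apply]; ring
    rw [h] at k1 k2
    have z1 : wedge 0 b = 0 := by ext i j; simp [wedge_apply]
    have z2 : wedge a 0 = 0 := by ext i j; simp [wedge_apply]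
    rw [z1] at k1; rw [z2] at k2
    exact ⟨(smul_eq_zero.1 k1).resolve_right hn, (smul_eq_zero.1 k2).resolve_right hn⟩
  obtain ⟨u, v, w, hu, hv, hw⟩ : ∃ u v w : Fin 6 → F, u ≠ 0 ∧
      wedge a b = wedge u v ∧ wedge c d = wedge u w := by
    rw [Fintype.linearIndependent_iff] at hdep
    push Not at hdep
    obtain ⟨g, hg, i, hi⟩ := hdep
    simp [Fin.sum_univ_four] at hg
    have hne : g 0 • a + g 1 • b ≠ 0 := by
      intro h
      rw [h, zero_add] at hg
      obtain ⟨q0, q1⟩ := ind _ _ _ _ n0 h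
      obtain ⟨q2, q3⟩ := ind _ _ _ _ n1 hg
      apply hi
      fin_cases i <;> assumption
    obtain ⟨v, hv⟩ := wedge_change (a := a) (b := b) rfl hne
    obtain ⟨w, hw⟩ := wedge_change (a := c) (b := d) (u := g 0 • a + g 1 • b)
      (x := - g 2) (y := - g 3) (by
        rw [← sub_eq_zero, ← hg]; module) hne
    exact ⟨_, v, w, hne, hv, hw⟩
  rw [hv] at hab
  rw [hw] at hcd
  have hs : LinearIndependent F ![u, v, w] := by
    rw [li_iff]
    intro x y z h
    simp only [Matrix.cons_val] at h
    rw [LinearIndependent.pair_iff] at hB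
    obtain ⟨hy, hz⟩ := hB y z (by
      rw [hab, hcd]
      have : y • wedge u v + z • wedge u w = wedge u (x • u + y • v + z • w) := by
        ext i j; simp [wedge_apply]; ring
      rw [this, h]
      ext i j; simp [wedge_apply])
    subst hy hz
    simp [hu] at h
    exact ⟨h, rfl, rfl⟩
  refine ⟨_, hs, ?_⟩
  apply Submodule.eq_of_le_of_finrank_eq
  · refine Submodule.span_le.2 ?_
    rintro _ ⟨i, rfl⟩
    fin_cases i
    · change wedge u v ∈ W
      rw [← hab]; exact (B 0).2
    · change wedge u w ∈ W
      rw [← hcd]; exact (B 1).2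
  · rw [finrank_phi hs, h2]

lemma card_eq (F : Type*) [Field F] [Fintype F] :
    Nat.card {s : Fin 3 → Fin 6 → F // LinearIndependent F s} =
    Nat.card {W : Submodule F (Matrix (Fin 6) (Fin 6) F) // Good W} * Nat.card (Par F) := by
  rw [← Nat.card_prod]
  symm
  choose σ hσ hσ' using fun W : {W : Submodule F (Matrix (Fin 6) (Fin 6) F) // Good W} =>
    phi_surj W.2
  refine Nat.card_congr (Equiv.ofBijective
    (fun x => (⟨act x.2 (σ x.1), act_li _ (hσ _)⟩ :
      {s : Fin 3 → Fin 6 → F // LinearIndependent F s})) ⟨?_, ?_⟩)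
  · rintro ⟨W, p⟩ ⟨W', p'⟩ h
    have h' : act p (σ W) = act p' (σ W') := congrArg Subtype.val h
    have hWW : W = W' := by
      apply Subtype.ext
      rw [← hσ' W, ← hσ' W', ← phi_act p (hσ W), ← phi_act p' (hσ W'), h']
    subst hWW
    rw [act_inj (hσ W) h']
  · rintro ⟨t, ht⟩
    obtain ⟨p, hp⟩ := fibre (hσ ⟨phi t, good_phi ht⟩) ht (hσ' ⟨phi t, good_phi ht⟩)
    exact ⟨(⟨phi t, good_phi ht⟩, p), Subtype.ext hp⟩

end PencilCount

/-- The number of 2-dimensional subspaces of the space of alternating 6×6 matrices over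
a finite field with `q` elements, in which every matrix has rank at most 2, equals
`(q³+1)(q²+1)(q²+q+1)(q⁴+q³+q²+q+1)`. -/

theorem stmt_8 (F : Type*) [Field F] [Fintype F] (q : ℕ) (hq : Fintype.card F = q) :
    Nat.card {W : Submodule F (Matrix (Fin 6) (Fin 6) F) //
      Module.finrank F W = 2 ∧
      ∀ A ∈ W, (Aᵀ = -A ∧ ∀ i, A i i = 0) ∧ A.rank ≤ 2} =
    (q ^ 3 + 1) * (q ^ 2 + 1) * (q ^ 2 + q + 1) *
      (q ^ 4 + q ^ 3 + q ^ 2 + q + 1) := by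
  classical
  have h := PencilCount.card_eq F
  have hq2 : 1 < q := hq ▸ Fintype.one_lt_card
  rw [card_linearIndependent (by simp), Nat.card_prod, Nat.card_prod, Nat.card_prod,
    Matrix.card_GL_field, Nat.card_units, Nat.card_eq_fintype_card (α := F), hq] at h
  simp only [Fin.prod_univ_three, Fin.prod_univ_two, Module.finrank_fintype_fun_eq_card,
    Fintype.card_fin] at h
  change Nat.card {W : Submodule F (Matrix (Fin 6) (Fin 6) F) // PencilCount.Good W} = _
  generalize Nat.card {W : Submodule F (Matrix (Fin 6) (Fin 6) F) // PencilCount.Good W} = n at h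
  simp only [Fin.val_zero, Fin.val_one, Fin.val_two, pow_zero, pow_one] at h
  have l1 : q ≤ q ^ 2 := Nat.le_self_pow (by norm_num) q
  have l2 : q ≤ q ^ 6 := Nat.le_self_pow (by norm_num) q
  have l3 : q ^ 2 ≤ q ^ 6 := Nat.pow_le_pow_right (by omega) (by norm_num)
  have l4 : 1 ≤ q ^ 6 := by omega
  have l5 : 1 ≤ q ^ 2 := by omega
  have l6 : 1 ≤ q := by omega
  zify [l1, l2, l3, l4, l5, l6] at h ⊢
  have hz : (1 : ℤ) < q := by exact_mod_cast hq2
  generalize (q : ℤ) = Q at *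
  have hne : (Q - 1) * (Q * (Q * ((Q ^ 2 - 1) * (Q ^ 2 - Q)))) ≠ 0 := by
    have a1 : 0 < Q - 1 := by linarith
    have a2 : 0 < Q := by linarith
    have a3 : 0 < Q ^ 2 - 1 := by nlinarith
    have a4 : 0 < Q ^ 2 - Q := by nlinarith
    positivity
  apply mul_right_cancel₀ hne
  rw [← h]
  ring
end
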